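/- arXiv:2207.07548 — 2 statements merged into one kernel-verified Lean document; each statement's English description precedes it below -/
import Mathlib

section
/- Let a ∈ ℝ, ω_av ∈ ℝ, and σ ≥ 1 be given. Let ω₀ ∈ B₀ have zero mean and satisfy ‖ω₀‖_{B₀} < 1/(4(|1+a| + |a|)). Let ϖ ∈ (0, 1) be such that ‖ω₀‖_{B₀} < (1 − ϖ)/(4(|1+a| + |a|)). Then there exists a unique ω ∈ B_ϖ^0 satisfying, for all t ≥ 0, the Duhamel fixed-point equation ω(·, t) = e^(−tL) ω₀ + ∫₀ᵗ e^(−(t−τ)L) P₀[(1+a) ω H(ω) − a (u ω)_x](·, τ) dτ, where u is determined from ω by u_x = H(ω) with zero mean. In particular, the initial value problem for the dissipative gCLM equation ω_t + a u ω_x = ω H(ω) + ω_av H(ω) − Λ^σ ω with this data has a unique global-in-time solution in B_ϖ^0. -/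
open MeasureTheory
open scoped ENNReal

noncomputable section

instance : Fact (0 < 2 * Real.pi) := ⟨by positivity⟩

/-- The Fourier multiplier symbol `e^(−s|k|^σ − i s ω_av sgn k)` of the semigroup `e^(−sL)`. -/
def heatMul (σ ωav s : ℝ) (k : ℤ) : ℂ :=
  Complex.exp (Complex.ofReal (-(s * (|k| : ℝ) ^ σ)) -
    Complex.I * Complex.ofReal (ωav * s * (Int.sign k : ℝ)))

/-- The norm `‖h‖_{ϖ,θ} = Σ_{k∈ℤ} (1 + |k|^θ) sup_{t∈[0,∞)} e^(ϖ t |k|) |ĥ(k, t)|`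
of the space `B_ϖ^θ`, valued in `ℝ≥0∞`.  For `θ = 0` the weight is `1 + |k|⁰ = 2`. -/
def wienerNorm (ϖ θ : ℝ) (h : ℝ → AddCircle (2 * Real.pi) → ℂ) : ℝ≥0∞ :=
  ∑' k : ℤ, ENNReal.ofReal (1 + (|k| : ℝ) ^ θ) *
    ⨆ t : {t : ℝ // 0 ≤ t},
      ENNReal.ofReal (Real.exp (ϖ * (t : ℝ) * (|k| : ℝ)) * ‖fourierCoeff (h (t : ℝ)) k‖)

/-- The periodic Hilbert transform `H`, the Fourier multiplier with symbol `−i sgn(k)`. -/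
def hilbertT (w : AddCircle (2 * Real.pi) → ℂ) : AddCircle (2 * Real.pi) → ℂ :=
  fun x => ∑' k : ℤ, (-Complex.I * (Int.sign k : ℝ)) * fourierCoeff w k * fourier k x

/-- The velocity `u` determined from `ω` by `u_x = H(ω)` with zero mean,
i.e. the Fourier multiplier `û(k) = −ω̂(k)/|k|` for `k ≠ 0`, `û(0) = 0`. -/
def velocity (w : AddCircle (2 * Real.pi) → ℂ) : AddCircle (2 * Real.pi) → ℂ :=
  fun x => ∑' k : ℤ,
    (if k = 0 then 0 else -fourierCoeff w k / ((|k| : ℝ) : ℂ)) * fourier k x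

/-- `ω` is a global solution, in the class `B_ϖ^0`, of the Duhamel fixed-point equation
`ω(·,t) = e^(−tL) ω₀ + ∫₀ᵗ e^(−(t−τ)L) P₀[(1+a) ω H(ω) − a (u ω)_x](·,τ) dτ`
for the dissipative gCLM equation `ω_t + a u ω_x = ω H(ω) + ω_av H(ω) − Λ^σ ω`,
expressed on the Fourier side (the coefficient of `(u ω)_x` being `i k` times that of `u ω`). -/
def IsDuhamelSol (a ωav σ ϖ : ℝ) (ω₀ : AddCircle (2 * Real.pi) → ℝ)
    (ω : ℝ → AddCircle (2 * Real.pi) → ℝ) : Prop :=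
  (∀ t : ℝ, 0 ≤ t → Integrable (fun x => (ω t x : ℂ)) volume) ∧
  wienerNorm ϖ 0 (fun t x => (ω t x : ℂ)) ≠ ⊤ ∧
  ∀ t : ℝ, 0 ≤ t → ∀ k : ℤ,
    fourierCoeff (fun x => (ω t x : ℂ)) k =
      heatMul σ ωav t k * fourierCoeff (fun x => (ω₀ x : ℂ)) k +
      ∫ τ in (0 : ℝ)..t, heatMul σ ωav (t - τ) k *
        (if k = 0 then 0 else
          ((1 + a : ℂ) *
              fourierCoeff (fun x => (ω τ x : ℂ) * hilbertT (fun y => (ω τ y : ℂ)) x) k -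
            (a : ℂ) * (Complex.I * (k : ℂ)) *
              fourierCoeff (fun x => velocity (fun y => (ω τ y : ℂ)) x * (ω τ x : ℂ)) k))

theorem norm_heatMul (σ ωav s : ℝ) (k : ℤ) :
    ‖heatMul σ ωav s k‖ = Real.exp (-(s * |(k : ℝ)| ^ σ)) := by
  rw [heatMul, Complex.norm_exp]
  congr 1
  rw [Complex.sub_re, Complex.ofReal_re, Complex.I_mul_re, Complex.ofReal_im]
  ring

theorem heatMul_add (σ ωav s t : ℝ) (k : ℤ) :
    heatMul σ ωav (s + t) k = heatMul σ ωav s k * heatMul σ ωav t k := by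
  rw [heatMul, heatMul, heatMul, ← Complex.exp_add]
  congr 1
  push_cast
  ring

theorem heatMul_zero_time (σ ωav : ℝ) (k : ℤ) : heatMul σ ωav 0 k = 1 := by
  simp [heatMul]

theorem heatMul_neg (σ ωav s : ℝ) (k : ℤ) :
    heatMul σ ωav s (-k) = starRingEnd ℂ (heatMul σ ωav s k) := by
  rw [heatMul, heatMul, ← Complex.exp_conj]
  congr 1
  simp only [map_sub, map_mul, Complex.conj_I, Complex.conj_ofReal, Int.sign_neg, Int.cast_neg,
    abs_neg]
  push_cast
  ring

@[fun_prop]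
theorem continuous_heatMul (σ ωav : ℝ) (k : ℤ) : Continuous fun s => heatMul σ ωav s k := by
  unfold heatMul
  fun_prop

theorem abs_intCast_le_rpow {σ : ℝ} (hσ : 1 ≤ σ) (k : ℤ) : |(k : ℝ)| ≤ |(k : ℝ)| ^ σ := by
  rcases eq_or_ne k 0 with rfl | hk
  · simpa using Real.rpow_nonneg le_rfl σ
  · have h1 : (1 : ℝ) ≤ |(k : ℝ)| := by exact_mod_cast Int.one_le_abs hk
    simpa using Real.rpow_le_rpow_of_exponent_le h1 hσ

theorem norm_heatMul_le {σ : ℝ} (hσ : 1 ≤ σ) (ωav : ℝ) {s : ℝ} (hs : 0 ≤ s) (k : ℤ) :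
    ‖heatMul σ ωav s k‖ ≤ Real.exp (-(s * |(k : ℝ)|)) := by
  rw [norm_heatMul]
  gcongr
  exact abs_intCast_le_rpow hσ k

theorem exp_mul_norm_heatMul_le_one {σ ϖ : ℝ} (hσ : 1 ≤ σ) (hϖ : ϖ < 1) (ωav : ℝ) {t : ℝ}
    (ht : 0 ≤ t) (k : ℤ) :
    Real.exp (ϖ * t * |(k : ℝ)|) * ‖heatMul σ ωav t k‖ ≤ 1 := by
  calc Real.exp (ϖ * t * |(k : ℝ)|) * ‖heatMul σ ωav t k‖
      ≤ Real.exp (ϖ * t * |(k : ℝ)|) * Real.exp (-(t * |(k : ℝ)|)) := by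
        gcongr; exact norm_heatMul_le hσ ωav ht k
    _ = Real.exp (-((1 - ϖ) * (t * |(k : ℝ)|))) := by rw [← Real.exp_add]; ring_nf
    _ ≤ 1 := Real.exp_le_one_iff.2 (neg_nonpos.2 (mul_nonneg (by linarith) (by positivity)))

/-- The parabolic smoothing estimate: the Duhamel integral gains the factor `(1 - ϖ)⁻¹ / |k|`. -/
theorem exp_mul_norm_duhamel_le {σ ϖ : ℝ} (hσ : 1 ≤ σ) (hϖ : ϖ < 1) (ωav : ℝ) {t C b : ℝ}
    (ht : 0 ≤ t) (hC : 0 ≤ C) (hb : 0 ≤ b) (k : ℤ) {g : ℝ → ℂ}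
    (hg : ∀ τ ∈ Set.Icc 0 t, ‖g τ‖ ≤ C * |(k : ℝ)| * Real.exp (-(ϖ * τ * |(k : ℝ)|)) * b) :
    Real.exp (ϖ * t * |(k : ℝ)|) * ‖∫ τ in (0 : ℝ)..t, heatMul σ ωav (t - τ) k * g τ‖ ≤
      C / (1 - ϖ) * b := by
  have hϖ' : 0 < 1 - ϖ := by linarith
  set m : ℝ := (1 - ϖ) * |(k : ℝ)| with hm
  have key : ∫ τ in (0 : ℝ)..t, Real.exp (-(m * (t - τ))) * m = 1 - Real.exp (-(m * t)) := by
    have := intervalIntegral.integral_eq_sub_of_hasDerivAt (a := 0) (b := t)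
      (f := fun τ => Real.exp (-(m * (t - τ)))) (f' := fun τ => Real.exp (-(m * (t - τ))) * m)
      (fun τ _ => by
        have h := (((hasDerivAt_id τ).const_sub t).const_mul m).neg.exp
        simpa using h)
      (Continuous.intervalIntegrable (by fun_prop) _ _)
    rw [this]
    simp
  have hbound : ‖∫ τ in (0 : ℝ)..t, heatMul σ ωav (t - τ) k * g τ‖ ≤
      ∫ τ in (0 : ℝ)..t, Real.exp (-(ϖ * t * |(k : ℝ)|)) * (C / (1 - ϖ) * b) *
        (Real.exp (-(m * (t - τ))) * m) := by
    refine intervalIntegral.norm_integral_le_of_norm_le ht ?_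
      (Continuous.intervalIntegrable (by fun_prop) _ _)
    refine Filter.Eventually.of_forall fun τ hτ => ?_
    have h1 := norm_heatMul_le hσ ωav (sub_nonneg.2 hτ.2) k
    have h2 := hg τ ⟨hτ.1.le, hτ.2⟩
    rw [norm_mul]
    calc ‖heatMul σ ωav (t - τ) k‖ * ‖g τ‖
        ≤ Real.exp (-((t - τ) * |(k : ℝ)|)) *
          (C * |(k : ℝ)| * Real.exp (-(ϖ * τ * |(k : ℝ)|)) * b) := by gcongr
      _ = (Real.exp (-((t - τ) * |(k : ℝ)|)) * Real.exp (-(ϖ * τ * |(k : ℝ)|))) *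
          (C * |(k : ℝ)| * b) := by ring
      _ = (Real.exp (-(ϖ * t * |(k : ℝ)|)) * Real.exp (-(m * (t - τ)))) *
          (C * |(k : ℝ)| * b) := by
        rw [← Real.exp_add, ← Real.exp_add, hm]; ring_nf
      _ = _ := by rw [hm]; field_simp
  rw [intervalIntegral.integral_const_mul, key] at hbound
  calc Real.exp (ϖ * t * |(k : ℝ)|) * ‖∫ τ in (0 : ℝ)..t, heatMul σ ωav (t - τ) k * g τ‖
      ≤ Real.exp (ϖ * t * |(k : ℝ)|) * (Real.exp (-(ϖ * t * |(k : ℝ)|)) * (C / (1 - ϖ) * b) *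
          (1 - Real.exp (-(m * t)))) := by gcongr
    _ = (Real.exp (ϖ * t * |(k : ℝ)|) * Real.exp (-(ϖ * t * |(k : ℝ)|))) *
          ((C / (1 - ϖ) * b) * (1 - Real.exp (-(m * t)))) := by ring
    _ = (C / (1 - ϖ) * b) * (1 - Real.exp (-(m * t))) := by
      rw [← Real.exp_add]; simp
    _ ≤ C / (1 - ϖ) * b := by
      refine mul_le_of_le_one_right (by positivity) ?_
      linarith [Real.exp_pos (-(m * t))]

/-- Young's inequality on `ℓ¹(ℤ)`, for nonnegative sequences, with equality of the sums. -/
theorem summable_conv {α β : ℤ → ℝ} (hα : Summable α) (hβ : Summable β) (hα0 : ∀ j, 0 ≤ α j)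
    (hβ0 : ∀ j, 0 ≤ β j) :
    (∀ k, Summable fun j => α j * β (k - j)) ∧ (Summable fun k => ∑' j, α j * β (k - j)) ∧
      ∑' k, ∑' j, α j * β (k - j) = (∑' j, α j) * ∑' j, β j := by
  let e : ℤ × ℤ ≃ ℤ × ℤ :=
    { toFun := fun p => (p.2, p.1 - p.2)
      invFun := fun q => (q.1 + q.2, q.1)
      left_inv := fun p => by simp
      right_inv := fun q => by simp }
  have hp : Summable fun q : ℤ × ℤ => α q.1 * β q.2 := hα.mul_of_nonneg hβ hα0 hβ0
  have hs : Summable fun p : ℤ × ℤ => α p.2 * β (p.1 - p.2) := e.summable_iff.2 hp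
  refine ⟨fun k => hs.prod_factor k, hs.prod, ?_⟩
  rw [← hs.tsum_prod, hα.tsum_mul_tsum hβ hp]
  exact e.tsum_eq fun q : ℤ × ℤ => α q.1 * β q.2

theorem tsum_conv_nonneg {α β : ℤ → ℝ} (hα0 : ∀ j, 0 ≤ α j) (hβ0 : ∀ j, 0 ≤ β j) (k : ℤ) :
    0 ≤ ∑' j, α j * β (k - j) :=
  tsum_nonneg fun j => mul_nonneg (hα0 j) (hβ0 _)

/-- The symbol of the quadratic nonlinearity `P₀[(1+a) ω H(ω) - a (u ω)_x]`. -/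
def nlSymbol (a : ℝ) (k j : ℤ) : ℂ :=
  if k = 0 then 0 else
    (1 + a : ℂ) * (-Complex.I * (Int.sign j : ℝ)) -
      (a : ℂ) * (Complex.I * (k : ℂ)) * (if j = 0 then 0 else -1 / ((|j| : ℝ) : ℂ))

/-- The `k`-th Fourier coefficient of the nonlinearity in terms of the coefficients of `ω`. -/
def nlMode (a : ℝ) (w : ℤ → ℂ) (k : ℤ) : ℂ :=
  ∑' j, nlSymbol a k j * (w j * w (k - j))

theorem norm_nlSymbol_le (a : ℝ) (k j : ℤ) :
    ‖nlSymbol a k j‖ ≤ (|1 + a| + |a|) * |(k : ℝ)| := by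
  unfold nlSymbol
  split_ifs with hk hj
  · simp [hk]
  · subst hj
    simp
    positivity
  · have h1 : (1 : ℝ) ≤ |(k : ℝ)| := by exact_mod_cast Int.one_le_abs hk
    have h2 : (1 : ℝ) ≤ |(j : ℝ)| := by exact_mod_cast Int.one_le_abs hj
    have h3 : ‖((Int.sign j : ℝ) : ℂ)‖ ≤ 1 := by
      rw [Complex.norm_real, Real.norm_eq_abs]
      rcases lt_trichotomy j 0 with h | h | h <;> simp [Int.sign_eq_neg_one_of_neg,
        Int.sign_eq_one_of_pos, h]
    have h4 : ‖(1 + a : ℂ)‖ = |1 + a| := by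
      rw [← Real.norm_eq_abs, ← Complex.norm_real]; push_cast; rfl
    refine (norm_sub_le _ _).trans ?_
    rw [norm_mul, norm_mul, norm_mul, norm_mul, norm_mul, norm_neg, norm_div, norm_neg, h4,
      Complex.norm_I, Complex.norm_real, Complex.norm_real, Complex.norm_real,
      Complex.norm_intCast]
    simp only [norm_one, one_mul, Real.norm_eq_abs, abs_abs]
    have h5 : 1 / |(j : ℝ)| ≤ 1 := by rw [div_le_one (by linarith)]; exact h2
    have h3' : |((Int.sign j : ℤ) : ℝ)| ≤ |(k : ℝ)| := by
      rw [Complex.norm_real, Real.norm_eq_abs] at h3; exact h3.trans h1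
    calc |1 + a| * |((Int.sign j : ℤ) : ℝ)| + |a| * |(k : ℝ)| * (1 / |(j : ℝ)|)
        ≤ |1 + a| * |(k : ℝ)| + |a| * |(k : ℝ)| * 1 := by gcongr
      _ = _ := by ring

theorem nlSymbol_neg (a : ℝ) (k j : ℤ) :
    nlSymbol a (-k) (-j) = starRingEnd ℂ (nlSymbol a k j) := by
  unfold nlSymbol
  by_cases hk : k = 0
  · simp [hk]
  by_cases hj : j = 0
  · simp [hk, hj]
  simp only [neg_eq_zero, hk, hj, if_false, map_sub, map_mul, map_add, map_one, map_neg, map_div₀,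
    Complex.conj_I, Complex.conj_ofReal, Int.sign_neg, Int.cast_neg, abs_neg]
  simp only [map_intCast]
  push_cast
  ring

theorem norm_nlMode_term_le (a : ℝ) {ϖ τ : ℝ} (hϖ : 0 ≤ ϖ) (hτ : 0 ≤ τ) {x y : ℂ} {α β : ℝ}
    (k j : ℤ) (hx : Real.exp (ϖ * τ * |(j : ℝ)|) * ‖x‖ ≤ α)
    (hy : Real.exp (ϖ * τ * |((k - j : ℤ) : ℝ)|) * ‖y‖ ≤ β) :
    ‖nlSymbol a k j * (x * y)‖ ≤
      (|1 + a| + |a|) * |(k : ℝ)| * Real.exp (-(ϖ * τ * |(k : ℝ)|)) * (α * β) := by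
  have hα : 0 ≤ α := le_trans (by positivity) hx
  have hk : |(k : ℝ)| ≤ |(j : ℝ)| + |((k - j : ℤ) : ℝ)| := by
    have := abs_add_le (j : ℝ) ((k - j : ℤ) : ℝ)
    push_cast at this ⊢
    simpa using this
  have hxy : ‖x‖ * ‖y‖ ≤ Real.exp (-(ϖ * τ * |(k : ℝ)|)) * (α * β) := by
    rw [Real.exp_neg, inv_mul_eq_div, le_div_iff₀ (Real.exp_pos _)]
    calc ‖x‖ * ‖y‖ * Real.exp (ϖ * τ * |(k : ℝ)|)
        ≤ ‖x‖ * ‖y‖ * Real.exp (ϖ * τ * (|(j : ℝ)| + |((k - j : ℤ) : ℝ)|)) := by gcongr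
      _ = (Real.exp (ϖ * τ * |(j : ℝ)|) * ‖x‖) *
          (Real.exp (ϖ * τ * |((k - j : ℤ) : ℝ)|) * ‖y‖) := by
        rw [mul_add, Real.exp_add]; ring
      _ ≤ α * β := by gcongr
  rw [norm_mul, norm_mul]
  calc ‖nlSymbol a k j‖ * (‖x‖ * ‖y‖)
      ≤ (|1 + a| + |a|) * |(k : ℝ)| * (Real.exp (-(ϖ * τ * |(k : ℝ)|)) * (α * β)) := by
        gcongr; exact norm_nlSymbol_le a k j
    _ = _ := by ring

section NonlinearBounds

variable {a ϖ τ : ℝ} {w w' : ℤ → ℂ} {α β δ : ℤ → ℝ}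

theorem norm_nlMode_le (hϖ : 0 ≤ ϖ) (hτ : 0 ≤ τ) (hα : Summable α)
    (hw : ∀ j : ℤ, Real.exp (ϖ * τ * |(j : ℝ)|) * ‖w j‖ ≤ α j) (k : ℤ) :
    (Summable fun j => nlSymbol a k j * (w j * w (k - j))) ∧
    ‖nlMode a w k‖ ≤ (|1 + a| + |a|) * |(k : ℝ)| * Real.exp (-(ϖ * τ * |(k : ℝ)|)) *
      ∑' j, α j * α (k - j) := by
  have hα0 : ∀ j, 0 ≤ α j := fun j => le_trans (by positivity) (hw j)
  have hs := ((summable_conv hα hα hα0 hα0).1 k).mul_left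
    ((|1 + a| + |a|) * |(k : ℝ)| * Real.exp (-(ϖ * τ * |(k : ℝ)|)))
  have hle := fun j => norm_nlMode_term_le a hϖ hτ k j (hw j) (hw (k - j))
  refine ⟨Summable.of_norm_bounded hs hle, ?_⟩
  rw [← tsum_mul_left]
  exact tsum_of_norm_bounded hs.hasSum hle

theorem norm_nlMode_sub_le (hϖ : 0 ≤ ϖ) (hτ : 0 ≤ τ) (hα : Summable α) (hβ : Summable β)
    (hδ : Summable δ)
    (hw : ∀ j : ℤ, Real.exp (ϖ * τ * |(j : ℝ)|) * ‖w j‖ ≤ α j)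
    (hw' : ∀ j : ℤ, Real.exp (ϖ * τ * |(j : ℝ)|) * ‖w' j‖ ≤ β j)
    (hd : ∀ j : ℤ, Real.exp (ϖ * τ * |(j : ℝ)|) * ‖w j - w' j‖ ≤ δ j) (k : ℤ) :
    ‖nlMode a w k - nlMode a w' k‖ ≤
      (|1 + a| + |a|) * |(k : ℝ)| * Real.exp (-(ϖ * τ * |(k : ℝ)|)) *
        (∑' j, δ j * α (k - j) + ∑' j, β j * δ (k - j)) := by
  have hα0 : ∀ j, 0 ≤ α j := fun j => le_trans (by positivity) (hw j)
  have hβ0 : ∀ j, 0 ≤ β j := fun j => le_trans (by positivity) (hw' j)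
  have hδ0 : ∀ j, 0 ≤ δ j := fun j => le_trans (by positivity) (hd j)
  have hs₁ := (summable_conv hδ hα hδ0 hα0).1 k
  have hs₂ := (summable_conv hβ hδ hβ0 hδ0).1 k
  rw [nlMode, nlMode, ← (norm_nlMode_le hϖ hτ hα hw k).1.tsum_sub
    (norm_nlMode_le hϖ hτ hβ hw' k).1, ← hs₁.tsum_add hs₂, ← tsum_mul_left]
  refine tsum_of_norm_bounded ((hs₁.add hs₂).mul_left _).hasSum fun j => ?_
  have h1 := norm_nlMode_term_le a hϖ hτ k j (hd j) (hw (k - j))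
  have h2 := norm_nlMode_term_le a hϖ hτ k j (hw' j) (hd (k - j))
  calc ‖nlSymbol a k j * (w j * w (k - j)) - nlSymbol a k j * (w' j * w' (k - j))‖
      = ‖nlSymbol a k j * ((w j - w' j) * w (k - j)) +
          nlSymbol a k j * (w' j * (w (k - j) - w' (k - j)))‖ := by congr 1; ring
    _ ≤ _ := (norm_add_le _ _).trans (add_le_add h1 h2)
    _ = _ := by ring

end NonlinearBounds

theorem exists_measurable_eqOn_primitive (g : ℝ → ℂ) :
    ∃ h : ℝ → ℂ, Measurable h ∧ ∀ t, 0 ≤ t → ∫ τ in (0 : ℝ)..t, g τ = h t := by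
  classical
  set S : Set ℝ := {t | 0 ≤ t ∧ IntervalIntegrable g volume 0 t} with hS
  have hmono : ∀ {s t : ℝ}, 0 ≤ s → s ≤ t → t ∈ S → s ∈ S := fun h0 h1 h2 =>
    ⟨h0, h2.2.mono_set (by
      rw [Set.uIcc_of_le h0, Set.uIcc_of_le h2.1]; exact Set.Icc_subset_Icc le_rfl h1)⟩
  have hmeas : MeasurableSet S :=
    Set.OrdConnected.measurableSet ⟨fun x hx y hy z hz => hmono (hx.1.trans hz.1) hz.2 hy⟩
  have hprim : ∀ t ∈ S, ContinuousOn (fun b => ∫ τ in (0 : ℝ)..b, g τ) (Set.Icc 0 t) := by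
    intro t ht
    simpa [Set.uIcc_of_le ht.1] using
      intervalIntegral.continuousOn_primitive_interval' ht.2 Set.left_mem_uIcc
  have hcont : ContinuousOn (fun b => ∫ τ in (0 : ℝ)..b, g τ) S := by
    intro t ht
    by_cases h : ∃ t' ∈ S, t < t'
    · obtain ⟨t', ht', hlt⟩ := h
      refine (hprim t' ht' t ⟨ht.1, hlt.le⟩).mono_of_mem_nhdsWithin ?_
      refine mem_nhdsWithin.2 ⟨Set.Iio t', isOpen_Iio, hlt, fun x hx => ⟨hx.2.1, hx.1.le⟩⟩
    · push Not at h
      exact (hprim t ht t ⟨ht.1, le_rfl⟩).mono fun x hx => ⟨hx.1, h x hx⟩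
  refine ⟨S.piecewise (fun b => ∫ τ in (0 : ℝ)..b, g τ) fun _ => 0,
    hcont.measurable_piecewise continuousOn_const hmeas, fun t ht => ?_⟩
  by_cases h : t ∈ S
  · rw [Set.piecewise_eq_of_mem _ _ _ h]
  · rw [Set.piecewise_eq_of_notMem _ _ _ h]
    exact intervalIntegral.integral_undef fun h' => h ⟨ht, h'⟩

/-- The Duhamel equation for the Fourier coefficients `f k t`, with initial coefficients `c k`. -/
def IsModeSol (a ωav σ : ℝ) (c : ℤ → ℂ) (f : ℤ → ℝ → ℂ) : Prop :=
  ∀ t, 0 ≤ t → ∀ k, f k t = heatMul σ ωav t k * c k +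
    ∫ τ in (0 : ℝ)..t, heatMul σ ωav (t - τ) k * nlMode a (fun j => f j τ) k

/-- The sequence `α ∈ ℓ¹` dominates the exponentially weighted coefficients `f k t`, `t ≥ 0`. -/
def IsModeBound (ϖ : ℝ) (α : ℤ → ℝ) (f : ℤ → ℝ → ℂ) : Prop :=
  Summable α ∧ ∀ (k : ℤ) (t : ℝ), 0 ≤ t → Real.exp (ϖ * t * |(k : ℝ)|) * ‖f k t‖ ≤ α k

theorem duhamel_eq_mul_primitive (σ ωav t : ℝ) (k : ℤ) (g : ℝ → ℂ) :
    ∫ τ in (0 : ℝ)..t, heatMul σ ωav (t - τ) k * g τ =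
      heatMul σ ωav t k * ∫ τ in (0 : ℝ)..t, heatMul σ ωav (-τ) k * g τ := by
  rw [← intervalIntegral.integral_const_mul]
  congr 1
  ext τ
  rw [sub_eq_add_neg, heatMul_add, mul_assoc]

section ModeSolutions

variable {a ωav σ ϖ : ℝ} {c : ℤ → ℂ} {f g : ℤ → ℝ → ℂ} {α β : ℤ → ℝ}

theorem IsModeBound.summable_mul (hα : IsModeBound ϖ α f) (hϖ : 0 ≤ ϖ) {τ : ℝ} (hτ : 0 ≤ τ)
    (k : ℤ) : Summable fun j => nlSymbol a k j * (f j τ * f (k - j) τ) :=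
  (norm_nlMode_le hϖ hτ hα.1 (fun j => hα.2 j τ hτ) k).1

theorem IsModeBound.norm_nlMode_le (hα : IsModeBound ϖ α f) (hϖ : 0 ≤ ϖ) {τ : ℝ} (hτ : 0 ≤ τ)
    (k : ℤ) : ‖nlMode a (fun j => f j τ) k‖ ≤ (|1 + a| + |a|) * |(k : ℝ)| *
      Real.exp (-(ϖ * τ * |(k : ℝ)|)) * ∑' j, α j * α (k - j) :=
  (_root_.norm_nlMode_le hϖ hτ hα.1 (fun j => hα.2 j τ hτ) k).2

theorem IsModeBound.nonneg (hα : IsModeBound ϖ α f) (k : ℤ) : 0 ≤ α k :=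
  le_trans (by positivity) (hα.2 k 0 le_rfl)

theorem IsModeSol.exists_measurable (hf : IsModeSol a ωav σ c f) (k : ℤ) :
    ∃ h : ℝ → ℂ, Measurable h ∧ ∀ t, 0 ≤ t → f k t = h t := by
  obtain ⟨h, hh, hh'⟩ := exists_measurable_eqOn_primitive
    fun τ => heatMul σ ωav (-τ) k * nlMode a (fun j => f j τ) k
  refine ⟨fun t => heatMul σ ωav t k * c k + heatMul σ ωav t k * h t, ?_, fun t ht => ?_⟩
  · have := (continuous_heatMul σ ωav k).measurable
    fun_prop
  · rw [hf t ht k, duhamel_eq_mul_primitive, hh' t ht]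

theorem IsModeSol.intervalIntegrable (hf : IsModeSol a ωav σ c f) (hϖ : 0 ≤ ϖ)
    (hα : IsModeBound ϖ α f) {t : ℝ} (ht : 0 ≤ t) (k : ℤ) :
    IntervalIntegrable (fun τ => nlMode a (fun j => f j τ) k) volume 0 t := by
  choose h hh hfh using fun k => hf.exists_measurable k
  set D : ℝ := (|1 + a| + |a|) * |(k : ℝ)| * ∑' j, α j * α (k - j) with hD
  have hmeas : AEStronglyMeasurable (fun τ => nlMode a (fun j => f j τ) k)
      (volume.restrict (Set.Ioc 0 t)) := by
    refine aestronglyMeasurable_of_tendsto_ae (Filter.atTop : Filter (Finset ℤ))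
      (f := fun s τ => ∑ j ∈ s, nlSymbol a k j * (h j τ * h (k - j) τ)) (fun s => ?_) ?_
    · have : Measurable fun τ => ∑ j ∈ s, nlSymbol a k j * (h j τ * h (k - j) τ) :=
        Finset.measurable_sum s fun j _ =>
          measurable_const.mul ((hh j).mul (hh (k - j)))
      exact this.aestronglyMeasurable
    · refine (ae_restrict_iff' measurableSet_Ioc).2 (Filter.Eventually.of_forall fun τ hτ => ?_)
      have : HasSum _ _ := (hα.summable_mul (a := a) hϖ hτ.1.le k).hasSum
      simp only [hfh _ τ hτ.1.le] at this
      simp only [nlMode, hfh _ τ hτ.1.le]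
      simpa [HasSum] using this
  rw [intervalIntegrable_iff_integrableOn_Ioc_of_le ht]
  refine Integrable.mono' (g := fun _ => D) (by simp) hmeas ?_
  refine (ae_restrict_iff' measurableSet_Ioc).2 (Filter.Eventually.of_forall fun τ hτ => ?_)
  refine (hα.norm_nlMode_le hϖ hτ.1.le k).trans ?_
  have h1 : Real.exp (-(ϖ * τ * |(k : ℝ)|)) ≤ 1 :=
    Real.exp_le_one_iff.2 (neg_nonpos.2 (mul_nonneg (mul_nonneg hϖ hτ.1.le) (abs_nonneg _)))
  have h2 := tsum_conv_nonneg hα.nonneg hα.nonneg k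
  exact mul_le_mul_of_nonneg_right (mul_le_of_le_one_right (by positivity) h1) h2

theorem IsModeSol.continuousOn (hf : IsModeSol a ωav σ c f) (hϖ : 0 ≤ ϖ)
    (hα : IsModeBound ϖ α f) (k : ℤ) : ContinuousOn (f k) (Set.Ici 0) := by
  have hprim : ContinuousOn (fun t => ∫ τ in (0 : ℝ)..t,
      heatMul σ ωav (-τ) k * nlMode a (fun j => f j τ) k) (Set.Ici 0) := by
    intro t ht
    have ht' : (0 : ℝ) ≤ t + 1 := by have : (0 : ℝ) ≤ t := ht; linarith
    have hi : IntervalIntegrable (fun τ => heatMul σ ωav (-τ) k * nlMode a (fun j => f j τ) k)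
        volume 0 (t + 1) :=
      (hf.intervalIntegrable hϖ hα ht' k).continuousOn_mul (by fun_prop)
    have hc := intervalIntegral.continuousOn_primitive_interval' hi Set.left_mem_uIcc
    rw [Set.uIcc_of_le ht'] at hc
    refine (hc t ⟨ht, by linarith⟩).mono_of_mem_nhdsWithin ?_
    exact mem_nhdsWithin.2 ⟨Set.Iio (t + 1), isOpen_Iio, by simp, fun x hx => ⟨hx.2, hx.1.le⟩⟩
  have hc := continuous_heatMul σ ωav k
  refine ContinuousOn.congr
    ((hc.continuousOn.mul continuousOn_const).add (hc.continuousOn.mul hprim))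
    (f := fun t => heatMul σ ωav t k * c k + heatMul σ ωav t k * ∫ τ in (0 : ℝ)..t,
      heatMul σ ωav (-τ) k * nlMode a (fun j => f j τ) k) fun t ht => ?_
  rw [hf t ht k, duhamel_eq_mul_primitive]

/-- The sum over `k` of `sup_{t ∈ [0,T]} e^(ϖ t |k|) |f k t|` is controlled by a continuous family
of `ℓ¹` sequences that are optimal bounds for each `T ≥ 0`. -/
theorem exists_optimal_bounds (hα : IsModeBound ϖ α f)
    (hf : ∀ k, ContinuousOn (f k) (Set.Ici 0)) :
    ∃ A : ℝ → ℤ → ℝ, (∀ T, Summable (A T)) ∧ (Continuous fun T => ∑' k, A T k) ∧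
      (∀ k, A 0 k = ‖f k 0‖) ∧
      (∀ T, ∀ t ∈ Set.Icc 0 T, ∀ k : ℤ, Real.exp (ϖ * t * |(k : ℝ)|) * ‖f k t‖ ≤ A T k) ∧
      ∀ T, 0 ≤ T → ∀ (k : ℤ) (B : ℝ),
        (∀ t ∈ Set.Icc 0 T, Real.exp (ϖ * t * |(k : ℝ)|) * ‖f k t‖ ≤ B) → A T k ≤ B := by
  set φ : ℤ → ℝ → ℝ := fun k t => Real.exp (ϖ * max t 0 * |(k : ℝ)|) * ‖f k (max t 0)‖ with hφ
  have hφc : ∀ k, Continuous (φ k) := fun k => by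
    have : Continuous fun t => f k (max t 0) :=
      (hf k).comp_continuous (by fun_prop) fun t => Set.mem_Ici.2 (le_max_right _ _)
    exact Continuous.mul (by fun_prop) this.norm
  have hφα : ∀ k t, φ k t ≤ α k := fun k t => hα.2 k _ (le_max_right _ _)
  have hφ0 : ∀ k t, 0 ≤ φ k t := fun k t => by positivity
  set A : ℝ → ℤ → ℝ := fun T k => sSup ((fun s => φ k (s * T)) '' Set.Icc 0 1) with hA
  have hne : (Set.Icc (0 : ℝ) 1).Nonempty := ⟨0, by simp⟩
  have hA0 : ∀ T k, 0 ≤ A T k := fun T k => Real.sSup_nonneg (by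
    rintro _ ⟨s, -, rfl⟩; exact hφ0 k _)
  have hAα : ∀ T k, A T k ≤ α k := fun T k => csSup_le (hne.image _) (by
    rintro _ ⟨s, -, rfl⟩; exact hφα k _)
  have hAc : ∀ k, Continuous fun T => A T k := fun k => by
    refine IsCompact.continuous_sSup (f := fun T s => φ k (s * T)) isCompact_Icc ?_
    have := hφc k
    exact this.comp (by fun_prop)
  have hle : ∀ T, ∀ t ∈ Set.Icc 0 T, ∀ k, φ k t ≤ A T k := by
    intro T t ht k
    refine le_csSup ⟨α k, by rintro _ ⟨s, -, rfl⟩; exact hφα k _⟩ ?_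
    rcases eq_or_lt_of_le (ht.1.trans ht.2) with h | h
    · refine ⟨0, by simp, ?_⟩
      have : t = 0 := le_antisymm (ht.2.trans h.ge) ht.1
      simp [this]
    · refine ⟨t / T, ⟨div_nonneg ht.1 h.le, (div_le_one h).2 ht.2⟩, ?_⟩
      simp only
      rw [div_mul_cancel₀ _ h.ne']
  refine ⟨A, fun T => Summable.of_nonneg_of_le (hA0 T) (hAα T) hα.1, ?_, fun k => ?_,
    fun T t ht k => ?_, fun T hT k B hB => ?_⟩
  · refine continuous_tsum hAc hα.1 fun k T => ?_
    rw [Real.norm_of_nonneg (hA0 T k)]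
    exact hAα T k
  · simp [hA, hφ, Set.Nonempty.image_const hne]
  · have := hle T t ht k
    simpa only [hφ, max_eq_left ht.1] using this
  · refine csSup_le (hne.image _) ?_
    rintro _ ⟨s, hs, rfl⟩
    have h0 : 0 ≤ s * T := mul_nonneg hs.1 hT
    simp only [hφ, max_eq_left h0]
    exact hB _ ⟨h0, mul_le_of_le_one_left hT hs.2⟩

theorem IsModeSol.exp_mul_norm_le (hσ : 1 ≤ σ) (hϖ : 0 ≤ ϖ) (hϖ1 : ϖ < 1)
    (hf : IsModeSol a ωav σ c f) (hα : Summable α) {T : ℝ}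
    (hT : ∀ t ∈ Set.Icc 0 T, ∀ k : ℤ, Real.exp (ϖ * t * |(k : ℝ)|) * ‖f k t‖ ≤ α k)
    (hα0 : ∀ k, 0 ≤ α k) {t : ℝ} (ht : t ∈ Set.Icc 0 T) (k : ℤ) :
    Real.exp (ϖ * t * |(k : ℝ)|) * ‖f k t‖ ≤
      ‖c k‖ + (|1 + a| + |a|) / (1 - ϖ) * ∑' j, α j * α (k - j) := by
  rw [hf t ht.1 k]
  have h1 := exp_mul_norm_heatMul_le_one hσ hϖ1 ωav ht.1 k
  have h2 := exp_mul_norm_duhamel_le hσ hϖ1 ωav ht.1 (by positivity)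
    (tsum_conv_nonneg hα0 hα0 k) k fun τ hτ => (_root_.norm_nlMode_le (a := a) hϖ hτ.1 hα
      (fun j => hT τ ⟨hτ.1, hτ.2.trans ht.2⟩ j) k).2
  refine (mul_le_mul_of_nonneg_left (norm_add_le _ _) (Real.exp_pos _).le).trans ?_
  rw [mul_add, norm_mul, ← mul_assoc]
  exact add_le_add (mul_le_of_le_one_left (norm_nonneg _) h1) h2

theorem exp_mul_norm_duhamel_sub_le (hσ : 1 ≤ σ) (hϖ : 0 ≤ ϖ) (hϖ1 : ϖ < 1) {δ : ℤ → ℝ}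
    (hα : Summable α) (hβ : Summable β) (hδ : Summable δ) {t : ℝ} (ht : 0 ≤ t)
    (hfα : ∀ τ ∈ Set.Icc 0 t, ∀ k : ℤ, Real.exp (ϖ * τ * |(k : ℝ)|) * ‖f k τ‖ ≤ α k)
    (hgβ : ∀ τ ∈ Set.Icc 0 t, ∀ k : ℤ, Real.exp (ϖ * τ * |(k : ℝ)|) * ‖g k τ‖ ≤ β k)
    (hd : ∀ τ ∈ Set.Icc 0 t, ∀ k : ℤ, Real.exp (ϖ * τ * |(k : ℝ)|) * ‖f k τ - g k τ‖ ≤ δ k)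
    (k : ℤ)
    (hf : IntervalIntegrable (fun τ => nlMode a (fun j => f j τ) k) volume 0 t)
    (hg : IntervalIntegrable (fun τ => nlMode a (fun j => g j τ) k) volume 0 t) :
    Real.exp (ϖ * t * |(k : ℝ)|) *
      ‖(∫ τ in (0 : ℝ)..t, heatMul σ ωav (t - τ) k * nlMode a (fun j => f j τ) k) -
        ∫ τ in (0 : ℝ)..t, heatMul σ ωav (t - τ) k * nlMode a (fun j => g j τ) k‖ ≤
      (|1 + a| + |a|) / (1 - ϖ) * (∑' j, δ j * α (k - j) + ∑' j, β j * δ (k - j)) := by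
  have h0 : (0 : ℝ) ∈ Set.Icc 0 t := ⟨le_rfl, ht⟩
  have hα0 : ∀ j, 0 ≤ α j := fun j => le_trans (by positivity) (hfα 0 h0 j)
  have hβ0 : ∀ j, 0 ≤ β j := fun j => le_trans (by positivity) (hgβ 0 h0 j)
  have hδ0 : ∀ j, 0 ≤ δ j := fun j => le_trans (by positivity) (hd 0 h0 j)
  rw [← intervalIntegral.integral_sub (hf.continuousOn_mul (by fun_prop))
    (hg.continuousOn_mul (by fun_prop))]
  simp only [← mul_sub]
  exact exp_mul_norm_duhamel_le hσ hϖ1 ωav ht (by positivity)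
    (add_nonneg (tsum_conv_nonneg hδ0 hα0 k) (tsum_conv_nonneg hβ0 hδ0 k)) k fun τ hτ =>
      norm_nlMode_sub_le hϖ hτ.1 hα hβ hδ (hfα τ hτ) (hgβ τ hτ) (hd τ hτ) k

/-- A priori bound: every solution in the class stays below half of the contraction threshold. -/
theorem IsModeSol.exists_small_bound (hσ : 1 ≤ σ) (hϖ : 0 ≤ ϖ) (hϖ1 : ϖ < 1)
    (hf : IsModeSol a ωav σ c f) (hα : IsModeBound ϖ α f)
    (hc : Summable fun k => ‖c k‖) (hpos : 0 < |1 + a| + |a|)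
    (hsmall : ∑' k, ‖c k‖ < (1 - ϖ) / (4 * (|1 + a| + |a|))) {T : ℝ} (hT : 0 ≤ T) :
    ∃ A : ℤ → ℝ, Summable A ∧ (|1 + a| + |a|) / (1 - ϖ) * ∑' k, A k < 1 / 2 ∧
      ∀ t ∈ Set.Icc 0 T, ∀ k : ℤ, Real.exp (ϖ * t * |(k : ℝ)|) * ‖f k t‖ ≤ A k := by
  obtain ⟨A, hAs, hAc, hA0, hA, hAmin⟩ :=
    exists_optimal_bounds hα (hf.continuousOn hϖ hα)
  set K : ℝ := (|1 + a| + |a|) / (1 - ϖ) with hK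
  have hϖ' : 0 < 1 - ϖ := by linarith
  have hKpos : 0 < K := by positivity
  have hsmall' : K * ∑' k, ‖c k‖ < 1 / 4 := by
    rw [lt_div_iff₀ (by positivity)] at hsmall
    rw [hK, div_mul_eq_mul_div, div_lt_iff₀ hϖ']
    linarith
  refine ⟨A T, hAs T, ?_, hA T⟩
  by_contra! hge
  have hcz : ∀ k, f k 0 = c k := fun k => by
    rw [hf 0 le_rfl k, heatMul_zero_time, intervalIntegral.integral_same]; ring
  have h00 : K * ∑' k, A 0 k ≤ 1 / 2 := by
    simp only [hA0, hcz]; linarith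
  obtain ⟨T', hT', hT'eq⟩ := intermediate_value_Icc hT
    (hAc.const_mul K).continuousOn (⟨h00, hge⟩ : (1 / 2 : ℝ) ∈ Set.Icc _ _)
  have hA0' : ∀ k, 0 ≤ A T' k := fun k =>
    le_trans (by positivity) (hA T' 0 ⟨le_rfl, hT'.1⟩ k)
  obtain ⟨-, hcs, hce⟩ := summable_conv (hAs T') (hAs T') hA0' hA0'
  have hle : ∑' k, A T' k ≤ ∑' k, (‖c k‖ + K * ∑' j, A T' j * A T' (k - j)) :=
    (hAs T').tsum_le_tsum (fun k => hAmin T' hT'.1 k _ fun t ht =>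
      hf.exp_mul_norm_le hσ hϖ hϖ1 (hAs T') (hA T') hA0' ht k) (hc.add (hcs.mul_left K))
  rw [hc.tsum_add (hcs.mul_left K), tsum_mul_left, hce] at hle
  simp only at hT'eq
  have := mul_le_mul_of_nonneg_left hle hKpos.le
  have h3 : K * (∑' k, ‖c k‖ + K * ((∑' k, A T' k) * ∑' k, A T' k)) =
      K * ∑' k, ‖c k‖ + (K * ∑' k, A T' k) * (K * ∑' k, A T' k) := by ring
  rw [h3, hT'eq] at this
  linarith

theorem IsModeSol.unique (hσ : 1 ≤ σ) (hϖ : 0 ≤ ϖ) (hϖ1 : ϖ < 1)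
    (hf : IsModeSol a ωav σ c f) (hα : IsModeBound ϖ α f)
    (hg : IsModeSol a ωav σ c g) (hβ : IsModeBound ϖ β g)
    (hc : Summable fun k => ‖c k‖) (hpos : 0 < |1 + a| + |a|)
    (hsmall : ∑' k, ‖c k‖ < (1 - ϖ) / (4 * (|1 + a| + |a|))) {T : ℝ} (hT : 0 ≤ T) (k : ℤ) :
    f k T = g k T := by
  obtain ⟨A, hAs, hAlt, hA⟩ := hf.exists_small_bound hσ hϖ hϖ1 hα hc hpos hsmall hT
  obtain ⟨B, hBs, hBlt, hB⟩ := hg.exists_small_bound hσ hϖ hϖ1 hβ hc hpos hsmall hT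
  have hγ : IsModeBound ϖ (fun k => α k + β k) fun k t => f k t - g k t :=
    ⟨hα.1.add hβ.1, fun k t ht =>
      (mul_le_mul_of_nonneg_left (norm_sub_le _ _) (Real.exp_pos _).le).trans
        (by rw [mul_add]; exact add_le_add (hα.2 k t ht) (hβ.2 k t ht))⟩
  obtain ⟨D, hDs, -, -, hD, hDmin⟩ := exists_optimal_bounds hγ fun k =>
    (hf.continuousOn hϖ hα k).sub (hg.continuousOn hϖ hβ k)
  set K : ℝ := (|1 + a| + |a|) / (1 - ϖ) with hK
  have hT0 : (0 : ℝ) ∈ Set.Icc 0 T := ⟨le_rfl, hT⟩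
  have hA0 : ∀ k, 0 ≤ A k := fun k => le_trans (by positivity) (hA 0 hT0 k)
  have hB0 : ∀ k, 0 ≤ B k := fun k => le_trans (by positivity) (hB 0 hT0 k)
  have hD0 : ∀ k, 0 ≤ D T k := fun k => le_trans (by positivity) (hD T 0 hT0 k)
  obtain ⟨-, hs₁, he₁⟩ := summable_conv (hDs T) hAs hD0 hA0
  obtain ⟨-, hs₂, he₂⟩ := summable_conv hBs (hDs T) hB0 hD0
  have hle : ∑' k, D T k ≤
      ∑' k, K * (∑' j, D T j * A (k - j) + ∑' j, B j * D T (k - j)) := by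
    refine (hDs T).tsum_le_tsum (fun k => hDmin T hT k _ fun t ht => ?_)
      ((hs₁.add hs₂).mul_left K)
    have hsub : Set.Icc 0 t ⊆ Set.Icc 0 T := Set.Icc_subset_Icc le_rfl ht.2
    have := exp_mul_norm_duhamel_sub_le (ωav := ωav) (a := a) hσ hϖ hϖ1 hAs hBs (hDs T) ht.1
      (fun τ hτ => hA τ (hsub hτ)) (fun τ hτ => hB τ (hsub hτ)) (fun τ hτ => hD T τ (hsub hτ)) k
      (hf.intervalIntegrable hϖ hα ht.1 k) (hg.intervalIntegrable hϖ hβ ht.1 k)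
    rw [hf t ht.1 k, hg t ht.1 k, add_sub_add_left_eq_sub]
    exact this
  rw [tsum_mul_left, hs₁.tsum_add hs₂, he₁, he₂] at hle
  have hDnn : 0 ≤ ∑' k, D T k := tsum_nonneg hD0
  have hDzero : ∑' k, D T k = 0 := by
    by_contra hne
    have hDpos : 0 < ∑' k, D T k := lt_of_le_of_ne hDnn (Ne.symm hne)
    nlinarith [mul_lt_mul_of_pos_right hAlt hDpos, mul_lt_mul_of_pos_right hBlt hDpos]
  have hDk : D T k ≤ 0 := hDzero ▸ (hDs T).le_tsum k fun j _ => hD0 j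
  have := (hD T T ⟨hT, le_rfl⟩ k).trans hDk
  have h0 : ‖f k T - g k T‖ ≤ 0 := nonpos_of_mul_nonpos_right this (Real.exp_pos _)
  exact sub_eq_zero.1 (norm_le_zero_iff.1 h0)

end ModeSolutions

section Existence

theorem continuous_nlMode (a : ℝ) {f : ℤ → ℝ → ℂ} {α : ℤ → ℝ} (hα : Summable α)
    (hf : ∀ k, Continuous (f k)) (hfα : ∀ k t, ‖f k t‖ ≤ α k) (k : ℤ) :
    Continuous fun τ => nlMode a (fun j => f j τ) k := by
  have hα0 : ∀ j, 0 ≤ α j := fun j => (norm_nonneg _).trans (hfα j 0)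
  refine continuous_tsum (fun j => by have := hf j; have := hf (k - j); fun_prop)
    (((summable_conv hα hα hα0 hα0).1 k).mul_left ((|1 + a| + |a|) * |(k : ℝ)|)) fun j τ => ?_
  simpa using norm_nlMode_term_le a (ϖ := 0) (τ := 0) le_rfl le_rfl k j
    (by simpa using hfα j τ) (by simpa using hfα (k - j) τ)

theorem continuous_duhamel (σ ωav : ℝ) (k : ℤ) {g : ℝ → ℂ} (hg : Continuous g) :
    Continuous fun t => ∫ τ in (0 : ℝ)..t, heatMul σ ωav (t - τ) k * g τ := by
  simp only [duhamel_eq_mul_primitive]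
  refine (continuous_heatMul σ ωav k).mul (intervalIntegral.continuous_primitive (fun _ _ =>
    Continuous.intervalIntegrable (by fun_prop) _ _) 0)

/-- Sequences of bounded continuous functions of time with summable uniform norms. -/
abbrev ModeSpace : Type := lp (fun _ : ℤ => BoundedContinuousFunction ℝ ℂ) 1

theorem ModeSpace.summable_norm (v : ModeSpace) : Summable fun k => ‖v k‖ := by
  simpa using (lp.memℓp v).summable (by simp)

theorem ModeSpace.norm_eq_tsum (v : ModeSpace) : ‖v‖ = ∑' k, ‖v k‖ := by
  simp [lp.norm_eq_tsum_rpow (p := 1) (by simp) v]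

theorem ModeSpace.exists_of_bound {h : ℤ → ℝ → ℂ} {γ : ℤ → ℝ} (hγ : Summable γ)
    (hc : ∀ k, Continuous (h k)) (hb : ∀ k t, ‖h k t‖ ≤ γ k) :
    ∃ w : ModeSpace, ∀ k t, w k t = h k t := by
  refine ⟨⟨fun k => BoundedContinuousFunction.ofNormedAddCommGroup (h k) (hc k) (γ k) (hb k),
    memℓp_gen ?_⟩, fun k t => rfl⟩
  simp only [ENNReal.toReal_one, Real.rpow_one]
  exact Summable.of_nonneg_of_le (fun _ => norm_nonneg _) (fun k =>
    BoundedContinuousFunction.norm_ofNormedAddCommGroup_le _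
      ((norm_nonneg _).trans (hb k 0)) (hb k)) hγ

theorem ModeSpace.norm_le_of_bound (w : ModeSpace) {γ : ℤ → ℝ} (hγ : Summable γ)
    (hb : ∀ k t, ‖w k t‖ ≤ γ k) : ‖w‖ ≤ ∑' k, γ k := by
  rw [w.norm_eq_tsum]
  exact w.summable_norm.tsum_le_tsum (fun k => (BoundedContinuousFunction.norm_le
    ((norm_nonneg _).trans (hb k 0))).2 (hb k)) hγ

/-- The unweighted coefficients associated with an element of the mode space. -/
def unweight (ϖ : ℝ) (v : ModeSpace) (k : ℤ) (t : ℝ) : ℂ :=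
  (Real.exp (-(ϖ * max t 0 * |(k : ℝ)|)) : ℂ) * v k t

theorem continuous_unweight (ϖ : ℝ) (v : ModeSpace) (k : ℤ) : Continuous (unweight ϖ v k) := by
  unfold unweight
  fun_prop

theorem unweight_sub (ϖ : ℝ) (v w : ModeSpace) (k : ℤ) (t : ℝ) :
    unweight ϖ (v - w) k t = unweight ϖ v k t - unweight ϖ w k t := by
  simp [unweight, mul_sub]

theorem norm_unweight_le {ϖ : ℝ} (hϖ : 0 ≤ ϖ) (v : ModeSpace) (k : ℤ) (t : ℝ) :
    ‖unweight ϖ v k t‖ ≤ ‖v k‖ := by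
  rw [unweight, norm_mul, Complex.norm_real, Real.norm_of_nonneg (Real.exp_pos _).le]
  refine (mul_le_of_le_one_left (norm_nonneg _) ?_).trans ((v k).norm_coe_le_norm t)
  exact Real.exp_le_one_iff.2 (neg_nonpos.2 (by positivity))

theorem exp_mul_norm_unweight_le (ϖ : ℝ) (v : ModeSpace) (k : ℤ) {t : ℝ} (ht : 0 ≤ t) :
    Real.exp (ϖ * t * |(k : ℝ)|) * ‖unweight ϖ v k t‖ ≤ ‖v k‖ := by
  rw [unweight, norm_mul, Complex.norm_real, Real.norm_of_nonneg (Real.exp_pos _).le,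
    max_eq_left ht, ← mul_assoc, ← Real.exp_add]
  simpa using (v k).norm_coe_le_norm t

theorem isModeBound_unweight (ϖ : ℝ) (v : ModeSpace) :
    IsModeBound ϖ (fun k => ‖v k‖) (unweight ϖ v) :=
  ⟨v.summable_norm, fun k _ ht => exp_mul_norm_unweight_le ϖ v k ht⟩

/-- A quadratic perturbation of a small constant has a fixed point. -/
theorem exists_fixedPoint_of_quadratic {E : Type*} [NormedAddCommGroup E] [CompleteSpace E]
    {F : E → E} {K s : ℝ} (hK : 0 ≤ K) (hF0 : ‖F 0‖ ≤ s) (hs : 4 * K * s < 1)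
    (hF : ∀ v w, ‖F v - F w‖ ≤ K * ((‖v‖ + ‖w‖) * ‖v - w‖)) : ∃ v, F v = v := by
  have hs0 : 0 ≤ s := (norm_nonneg _).trans hF0
  have hmaps : Set.MapsTo F (Metric.closedBall 0 (2 * s)) (Metric.closedBall 0 (2 * s)) := by
    intro v hv
    rw [mem_closedBall_zero_iff] at hv ⊢
    have h1 := hF v 0
    rw [norm_zero, add_zero, sub_zero] at h1
    have h2 : K * (‖v‖ * ‖v‖) ≤ K * ((2 * s) * (2 * s)) := by gcongr
    have h3 : ‖F v‖ ≤ ‖F v - F 0‖ + ‖F 0‖ := by simpa using norm_add_le (F v - F 0) (F 0)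
    nlinarith
  have hcontr : ContractingWith (4 * K * s).toNNReal (hmaps.restrict F _ _) := by
    refine ⟨by rw [← NNReal.coe_lt_coe, Real.coe_toNNReal _ (by positivity)]; exact hs,
      LipschitzWith.of_dist_le_mul fun v w => ?_⟩
    rw [Real.coe_toNNReal _ (by positivity), Subtype.dist_eq, Subtype.dist_eq, dist_eq_norm,
      dist_eq_norm]
    have hv := mem_closedBall_zero_iff.1 v.2
    have hw := mem_closedBall_zero_iff.1 w.2
    refine (hF v w).trans ?_
    calc K * ((‖(v : E)‖ + ‖(w : E)‖) * ‖(v : E) - w‖)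
        ≤ K * ((2 * s + 2 * s) * ‖(v : E) - w‖) := by gcongr
      _ = 4 * K * s * ‖(v : E) - w‖ := by ring
  obtain ⟨v, -, hv, -⟩ := hcontr.exists_fixedPoint' (x := 0) Metric.isClosed_closedBall.isComplete
    hmaps (Metric.mem_closedBall_self (by positivity)) (edist_ne_top _ _)
  exact ⟨v, hv⟩

theorem exists_isModeSol {a σ ϖ : ℝ} (ωav : ℝ) (hσ : 1 ≤ σ) (hϖ : 0 ≤ ϖ) (hϖ1 : ϖ < 1)
    {c : ℤ → ℂ} (hc : Summable fun k => ‖c k‖) (hpos : 0 < |1 + a| + |a|)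
    (hsmall : ∑' k, ‖c k‖ < (1 - ϖ) / (4 * (|1 + a| + |a|))) :
    ∃ f α, IsModeSol a ωav σ c f ∧ IsModeBound ϖ α f := by
  have hϖ' : 0 < 1 - ϖ := by linarith
  set K : ℝ := (|1 + a| + |a|) / (1 - ϖ) with hK
  set I : ModeSpace → ℤ → ℝ → ℂ := fun v k t => ∫ τ in (0 : ℝ)..t,
    heatMul σ ωav (t - τ) k * nlMode a (fun j => unweight ϖ v j τ) k with hI
  have hNc : ∀ v k, Continuous fun τ => nlMode a (fun j => unweight ϖ v j τ) k := fun v k =>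
    continuous_nlMode a v.summable_norm (continuous_unweight ϖ v) (norm_unweight_le hϖ v) k
  have hIc : ∀ v k, Continuous (I v k) := fun v k => continuous_duhamel σ ωav k (hNc v k)
  have hI0 : ∀ k t, I 0 k t = 0 := fun k t => by simp [hI, nlMode, unweight]
  have hIsub : ∀ v w (k : ℤ) (t : ℝ), 0 ≤ t → Real.exp (ϖ * t * |(k : ℝ)|) * ‖I v k t - I w k t‖ ≤
      K * (∑' j, ‖(v - w) j‖ * ‖v (k - j)‖ + ∑' j, ‖w j‖ * ‖(v - w) (k - j)‖) := by
    intro v w k t ht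
    refine exp_mul_norm_duhamel_sub_le hσ hϖ hϖ1 v.summable_norm w.summable_norm
      (v - w).summable_norm ht (fun τ hτ k => exp_mul_norm_unweight_le ϖ v k hτ.1)
      (fun τ hτ k => exp_mul_norm_unweight_le ϖ w k hτ.1) (fun τ hτ k => ?_) k
      ((hNc v k).intervalIntegrable _ _) ((hNc w k).intervalIntegrable _ _)
    rw [← unweight_sub]
    exact exp_mul_norm_unweight_le ϖ (v - w) k hτ.1
  have hconv := fun v w : ModeSpace => summable_conv v.summable_norm w.summable_norm
    (fun _ => norm_nonneg _) (fun _ => norm_nonneg _)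
  have hex : ∀ v : ModeSpace, ∃ w : ModeSpace, ∀ k t, w k t =
      (Real.exp (ϖ * max t 0 * |(k : ℝ)|) : ℂ) *
        (heatMul σ ωav (max t 0) k * c k + I v k (max t 0)) := by
    intro v
    refine ModeSpace.exists_of_bound
      (γ := fun k => ‖c k‖ + K * (∑' j, ‖(v - 0) j‖ * ‖v (k - j)‖ +
        ∑' j, ‖(0 : ModeSpace) j‖ * ‖(v - 0) (k - j)‖))
      (hc.add (((hconv (v - 0) v).2.1.add (hconv 0 (v - 0)).2.1).mul_left K))
      (fun k => ?_) fun k t => ?_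
    · have := hIc v k
      fun_prop
    · have ht := le_max_right t 0
      have h1 := exp_mul_norm_heatMul_le_one hσ hϖ1 ωav ht k
      have h2 := hIsub v 0 k _ ht
      rw [hI0, sub_zero (I v k _)] at h2
      rw [norm_mul, Complex.norm_real, Real.norm_of_nonneg (Real.exp_pos _).le]
      refine (mul_le_mul_of_nonneg_left (norm_add_le _ _) (Real.exp_pos _).le).trans ?_
      rw [mul_add, norm_mul, ← mul_assoc]
      exact add_le_add (mul_le_of_le_one_left (norm_nonneg _) h1) h2
  choose F hF using hex
  obtain ⟨v, hv⟩ : ∃ v, F v = v := by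
    refine exists_fixedPoint_of_quadratic (K := K) (s := ∑' k, ‖c k‖) (by positivity) ?_ ?_ ?_
    · refine (F 0).norm_le_of_bound hc fun k t => ?_
      have h1 := exp_mul_norm_heatMul_le_one hσ hϖ1 ωav (le_max_right t 0) k
      rw [hF, hI0, add_zero, norm_mul, Complex.norm_real, Real.norm_of_nonneg (Real.exp_pos _).le,
        norm_mul, ← mul_assoc]
      exact mul_le_of_le_one_left (norm_nonneg _) h1
    · rw [lt_div_iff₀ (by positivity)] at hsmall
      rw [hK, mul_div_assoc', div_mul_eq_mul_div, div_lt_one hϖ']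
      linarith
    · intro v w
      have hs₁ := hconv (v - w) v
      have hs₂ := hconv w (v - w)
      refine ((F v - F w).norm_le_of_bound ((hs₁.2.1.add hs₂.2.1).mul_left K)
        fun k t => ?_).trans_eq ?_
      · have h : (F v - F w) k t = F v k t - F w k t := by simp
        rw [h, hF, hF, ← mul_sub, add_sub_add_left_eq_sub, norm_mul, Complex.norm_real,
          Real.norm_of_nonneg (Real.exp_pos _).le]
        exact hIsub v w k _ (le_max_right t 0)
      · rw [tsum_mul_left, hs₁.2.1.tsum_add hs₂.2.1, hs₁.2.2, hs₂.2.2, ← v.norm_eq_tsum,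
          ← w.norm_eq_tsum, ← (v - w).norm_eq_tsum]
        ring
  refine ⟨unweight ϖ v, _, fun t ht k => ?_, isModeBound_unweight ϖ v⟩
  have h := hF v k t
  rw [hv, max_eq_left ht] at h
  rw [unweight, h, max_eq_left ht, ← mul_assoc, ← Complex.ofReal_mul, ← Real.exp_add]
  simp [hI]

theorem nlMode_conj_neg (a : ℝ) (w : ℤ → ℂ) (k : ℤ) :
    nlMode a (fun j => starRingEnd ℂ (w (-j))) k = starRingEnd ℂ (nlMode a w (-k)) := by
  rw [nlMode, nlMode, Complex.conj_tsum, ← (Equiv.neg ℤ).tsum_eq]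
  refine tsum_congr fun j => ?_
  have h := nlSymbol_neg a (-k) j
  rw [neg_neg] at h
  simp only [Equiv.neg_apply, h, map_mul, neg_neg]
  congr 4
  ring

theorem IsModeSol.conj_neg {a ωav σ : ℝ} {c : ℤ → ℂ} {f : ℤ → ℝ → ℂ}
    (hf : IsModeSol a ωav σ c f) (hc : ∀ k, c (-k) = starRingEnd ℂ (c k)) :
    IsModeSol a ωav σ c fun k t => starRingEnd ℂ (f (-k) t) := by
  intro t ht k
  simp only [hf t ht (-k), map_add, map_mul, hc, heatMul_neg, Complex.conj_conj,
    fun τ => nlMode_conj_neg a (fun j => f j τ) k, ← intervalIntegral.intervalIntegral_conj]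

theorem IsModeBound.conj_neg {ϖ : ℝ} {α : ℤ → ℝ} {f : ℤ → ℝ → ℂ} (hα : IsModeBound ϖ α f) :
    IsModeBound ϖ (fun k => α (-k)) fun k t => starRingEnd ℂ (f (-k) t) :=
  ⟨(Equiv.neg ℤ).summable_iff.2 hα.1, fun k t ht => by
    simpa using hα.2 (-k) t ht⟩

end Existence

theorem continuous_tsum_fourier {T : ℝ} {c : ℤ → ℂ} (hc : Summable fun k => ‖c k‖) :
    Continuous fun x : AddCircle T => ∑' j, c j * fourier j x :=
  continuous_tsum (fun j => by fun_prop) hc fun j x => by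
    rw [norm_mul, fourier_apply, Circle.norm_coe, mul_one]

section Fourier

variable {T : ℝ} [hT : Fact (0 < T)]

theorem integrable_haarAddCircle_iff {f : AddCircle T → ℂ} :
    Integrable f AddCircle.haarAddCircle ↔ Integrable f volume := by
  rw [AddCircle.volume_eq_smul_haarAddCircle, integrable_smul_measure
    (ENNReal.ofReal_pos.2 hT.out).ne' ENNReal.ofReal_ne_top]

theorem fourierCoeff_mul_tsum {w : AddCircle T → ℂ}
    (hw : Integrable w AddCircle.haarAddCircle) {c : ℤ → ℂ} (hc : Summable fun k => ‖c k‖)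
    (k : ℤ) :
    fourierCoeff (fun x => w x * ∑' j, c j * fourier j x) k =
      ∑' j, c j * fourierCoeff w (k - j) := by
  have hint : ∀ j, Integrable (fun x => c j * (fourier (-(k - j)) x • w x))
      AddCircle.haarAddCircle := fun j => (hw.fourier_smul _).const_mul _
  have hsum := integral_tsum_of_summable_integral_norm hint (by
    have : ∀ (j : ℤ) (x : AddCircle T),
        ‖c j * (fourier (-(k - j)) x • w x)‖ = ‖c j‖ * ‖w x‖ := fun j x => by
      rw [norm_mul, norm_smul, fourier_apply, Circle.norm_coe, one_mul]
    simp only [this, integral_const_mul]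
    exact hc.mul_right _)
  simp only [fourierCoeff, ← integral_const_mul]
  rw [hsum]
  congr 1
  ext x
  rw [smul_eq_mul, ← mul_assoc, ← tsum_mul_left]
  refine tsum_congr fun j => ?_
  rw [show -(k - j) = -k + j by ring, fourier_add, smul_eq_mul]
  ring

theorem fourierCoeff_one (k : ℤ) :
    fourierCoeff (fun _ : AddCircle T => (1 : ℂ)) k = if k = 0 then 1 else 0 := by
  have h : (fun _ : AddCircle T => (1 : ℂ)) = fourier 0 := by
    ext x
    exact fourier_zero.symm
  rw [h, fourierCoeff_fourier, Pi.single_apply]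

theorem fourierCoeff_tsum {c : ℤ → ℂ} (hc : Summable fun k => ‖c k‖) (k : ℤ) :
    fourierCoeff (fun x : AddCircle T => ∑' j, c j * fourier j x) k = c k := by
  have h := fourierCoeff_mul_tsum (T := T) (integrable_const (1 : ℂ)) hc k
  simp only [one_mul] at h
  rw [h, tsum_eq_single k fun j hj => by
    rw [fourierCoeff_one, if_neg (sub_ne_zero.2 hj.symm), mul_zero], fourierCoeff_one]
  simp

theorem fourierCoeff_ofReal_neg (w : AddCircle T → ℝ) (k : ℤ) :
    fourierCoeff (fun x => (w x : ℂ)) (-k) =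
      starRingEnd ℂ (fourierCoeff (fun x => (w x : ℂ)) k) := by
  rw [fourierCoeff, fourierCoeff, ← integral_conj]
  congr 1
  ext x
  rw [smul_eq_mul, smul_eq_mul, map_mul, Complex.conj_ofReal, fourier_neg]

/-- An integrable function on the circle with vanishing Fourier coefficients vanishes a.e. -/
theorem ae_eq_zero_of_fourierCoeff_eq_zero {g : AddCircle T → ℂ}
    (hg : Integrable g AddCircle.haarAddCircle) (h : ∀ k, fourierCoeff g k = 0) :
    g =ᵐ[AddCircle.haarAddCircle] 0 := by
  have hbdd : ∀ φ : C(AddCircle T, ℂ), Integrable (fun x => φ x * g x)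
      AddCircle.haarAddCircle := fun φ =>
    hg.bdd_mul φ.continuous.aestronglyMeasurable (Filter.Eventually.of_forall φ.norm_coe_le_norm)
  let L : C(AddCircle T, ℂ) →ₗ[ℂ] ℂ :=
    { toFun := fun φ => ∫ x, φ x * g x ∂AddCircle.haarAddCircle
      map_add' := fun φ ψ => by
        rw [← integral_add (hbdd φ) (hbdd ψ)]; simp [add_mul]
      map_smul' := fun r φ => by
        rw [RingHom.id_apply, smul_eq_mul, ← integral_const_mul]; simp [mul_assoc] }
  have hL : Continuous L := by
    refine AddMonoidHomClass.continuous_of_bound L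
      (∫ x, ‖g x‖ ∂AddCircle.haarAddCircle) fun φ => ?_
    rw [mul_comm, ← integral_const_mul]
    refine norm_integral_le_of_norm_le (hg.norm.const_mul _)
      (Filter.Eventually.of_forall fun x => ?_)
    rw [norm_mul]
    gcongr
    exact φ.norm_coe_le_norm x
  have hker : ∀ φ, L φ = 0 := by
    have hcl : IsClosed {φ | L φ = 0} := isClosed_eq hL continuous_const
    have hspan : (Submodule.span ℂ (Set.range (@fourier T))) ≤ LinearMap.ker L := by
      rw [Submodule.span_le]
      rintro _ ⟨k, rfl⟩
      have hk := h (-k)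
      rw [fourierCoeff, neg_neg] at hk
      exact hk
    have hle := Submodule.topologicalClosure_minimal _ hspan hcl
    rw [span_fourier_closure_eq_top] at hle
    exact fun φ => hle Submodule.mem_top
  refine ae_eq_zero_of_forall_setIntegral_isClosed_eq_zero hg fun s hs => ?_
  have hlim : Filter.Tendsto
      (fun n => ∫ x, ((hs.apprSeq n x : ℝ) : ℂ) * g x ∂AddCircle.haarAddCircle) Filter.atTop
      (nhds (∫ x, s.indicator g x ∂AddCircle.haarAddCircle)) := by
    refine tendsto_integral_of_dominated_convergence (fun x => ‖g x‖) (fun n => ?_) hg.norm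
      (fun n => Filter.Eventually.of_forall fun x => ?_)
      (Filter.Eventually.of_forall fun x => ?_)
    · exact Continuous.aestronglyMeasurable (by fun_prop) |>.mul hg.aestronglyMeasurable
    · rw [norm_mul, Complex.norm_real, Real.norm_of_nonneg (NNReal.coe_nonneg _)]
      exact mul_le_of_le_one_left (norm_nonneg _)
        (by exact_mod_cast HasOuterApproxClosed.apprSeq_apply_le_one hs n x)
    · have h1 := tendsto_pi_nhds.1 (HasOuterApproxClosed.tendsto_apprSeq hs) x
      have h2 : Filter.Tendsto (fun n => ((hs.apprSeq n x : ℝ) : ℂ) * g x) Filter.atTop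
          (nhds ((((s.indicator (fun _ => (1 : NNReal)) x : NNReal) : ℝ) : ℂ) * g x)) :=
        ((Complex.continuous_ofReal.tendsto _).comp
          ((NNReal.continuous_coe.tendsto _).comp h1)).mul_const _
      convert h2 using 2
      by_cases hx : x ∈ s <;> simp [hx]
  have hzero : ∀ n, ∫ x, ((hs.apprSeq n x : ℝ) : ℂ) * g x ∂AddCircle.haarAddCircle = 0 :=
    fun n => hker ⟨fun x => ((hs.apprSeq n x : ℝ) : ℂ), by fun_prop⟩
  simp only [hzero] at hlim
  rw [← integral_indicator hs.measurableSet]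
  exact (tendsto_nhds_unique tendsto_const_nhds hlim).symm

theorem ae_eq_of_fourierCoeff_ofReal_eq {v w : AddCircle T → ℝ}
    (hv : Integrable (fun x => (v x : ℂ)) volume) (hw : Integrable (fun x => (w x : ℂ)) volume)
    (h : ∀ k, fourierCoeff (fun x => (v x : ℂ)) k = fourierCoeff (fun x => (w x : ℂ)) k) :
    v =ᵐ[volume] w := by
  rw [← integrable_haarAddCircle_iff] at hv hw
  have hzero := ae_eq_zero_of_fourierCoeff_eq_zero (hv.sub hw) fun k => by
    have hk := h k
    rw [fourierCoeff, fourierCoeff] at hk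
    rw [fourierCoeff]
    simp only [Pi.sub_apply, smul_sub]
    rw [integral_sub (hv.fourier_smul _) (hw.fourier_smul _), hk, sub_self]
  rw [AddCircle.volume_eq_smul_haarAddCircle]
  refine Measure.ae_smul_measure ?_ _
  filter_upwards [hzero] with x hx
  have hx' : (v x : ℂ) = w x := sub_eq_zero.1 hx
  exact_mod_cast hx'

end Fourier

theorem wienerNorm_ne_top_iff {ϖ : ℝ} {h : ℝ → AddCircle (2 * Real.pi) → ℂ} :
    wienerNorm ϖ 0 h ≠ ⊤ ↔ ∃ α, IsModeBound ϖ α fun k t => fourierCoeff (h t) k := by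
  have h2 : ∀ k : ℤ, (1 : ℝ) + |(k : ℝ)| ^ (0 : ℝ) = 2 := fun k => by
    rw [Real.rpow_zero]; norm_num
  simp only [wienerNorm, h2]
  constructor
  · intro hfin
    refine ⟨_, ENNReal.summable_toReal hfin, fun k t ht => ?_⟩
    rw [← ENNReal.ofReal_le_iff_le_toReal (ENNReal.ne_top_of_tsum_ne_top hfin k)]
    refine (le_iSup (fun t : {t : ℝ // 0 ≤ t} =>
      ENNReal.ofReal (Real.exp (ϖ * (t : ℝ) * |(k : ℝ)|) * ‖fourierCoeff (h (t : ℝ)) k‖))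
      ⟨t, ht⟩).trans ?_
    exact le_mul_of_one_le_left zero_le (by rw [ENNReal.one_le_ofReal]; norm_num)
  · rintro ⟨α, hαs, hα⟩
    refine ne_top_of_le_ne_top (hαs.mul_left 2).tsum_ofReal_ne_top
      (ENNReal.tsum_le_tsum fun k => ?_)
    rw [ENNReal.ofReal_mul (by norm_num)]
    gcongr
    exact iSup_le fun t => ENNReal.ofReal_le_ofReal (hα k t t.2)

theorem nonlinearity_eq_nlMode (a : ℝ) {w : AddCircle (2 * Real.pi) → ℂ}
    (hw : Integrable w volume) (hs : Summable fun k => ‖fourierCoeff w k‖) (k : ℤ) :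
    (if k = 0 then 0 else
      ((1 + a : ℂ) * fourierCoeff (fun x => w x * hilbertT w x) k -
        (a : ℂ) * (Complex.I * (k : ℂ)) * fourierCoeff (fun x => velocity w x * w x) k)) =
      nlMode a (fourierCoeff w) k := by
  rw [← integrable_haarAddCircle_iff] at hw
  split_ifs with hk
  · simp [nlMode, nlSymbol, hk]
  have hle₁ : ∀ j : ℤ, ‖(-Complex.I * (Int.sign j : ℝ)) * fourierCoeff w j‖ ≤
      ‖fourierCoeff w j‖ := fun j => by
    rw [norm_mul]
    refine mul_le_of_le_one_left (norm_nonneg _) ?_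
    rcases lt_trichotomy j 0 with h | h | h <;> simp [Int.sign_eq_neg_one_of_neg,
      Int.sign_eq_one_of_pos, h]
  have hle₂ : ∀ j : ℤ, ‖(if j = 0 then 0 else -fourierCoeff w j / ((|j| : ℝ) : ℂ))‖ ≤
      ‖fourierCoeff w j‖ := fun j => by
    split_ifs with hj
    · simp
    · have h1 : (1 : ℝ) ≤ |(j : ℝ)| := by exact_mod_cast Int.one_le_abs hj
      rw [norm_div, norm_neg, Complex.norm_real, Real.norm_eq_abs, abs_abs]
      exact div_le_self (norm_nonneg _) h1
  have hconv := (summable_conv hs hs (fun _ => norm_nonneg _) (fun _ => norm_nonneg _)).1 k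
  have hs₁ := Summable.of_norm_bounded hconv fun j => (norm_mul_le
    ((-Complex.I * (Int.sign j : ℝ)) * fourierCoeff w j) (fourierCoeff w (k - j))).trans
      (mul_le_mul_of_nonneg_right (hle₁ j) (norm_nonneg _))
  have hs₂ := Summable.of_norm_bounded hconv fun j => (norm_mul_le
    (if j = 0 then 0 else -fourierCoeff w j / ((|j| : ℝ) : ℂ)) (fourierCoeff w (k - j))).trans
      (mul_le_mul_of_nonneg_right (hle₂ j) (norm_nonneg _))
  have h1 := fourierCoeff_mul_tsum hw
    (hs.of_nonneg_of_le (fun _ => norm_nonneg _) hle₁) k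
  have h2 := fourierCoeff_mul_tsum hw
    (hs.of_nonneg_of_le (fun _ => norm_nonneg _) hle₂) k
  simp only [hilbertT, velocity, mul_comm _ (w _)]
  rw [h1, h2, ← tsum_mul_left, ← tsum_mul_left, ← (hs₁.mul_left _).tsum_sub (hs₂.mul_left _),
    nlMode]
  refine tsum_congr fun j => ?_
  simp only [nlSymbol, if_neg hk]
  split_ifs with hj
  · ring
  · ring

theorem isDuhamelSol_iff {a ωav σ ϖ : ℝ} (hϖ : 0 ≤ ϖ) {ω₀ : AddCircle (2 * Real.pi) → ℝ}
    {ω : ℝ → AddCircle (2 * Real.pi) → ℝ} :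
    IsDuhamelSol a ωav σ ϖ ω₀ ω ↔
      (∀ t : ℝ, 0 ≤ t → Integrable (fun x => (ω t x : ℂ)) volume) ∧
      (∃ α, IsModeBound ϖ α fun k t => fourierCoeff (fun x => (ω t x : ℂ)) k) ∧
      IsModeSol a ωav σ (fourierCoeff fun x => (ω₀ x : ℂ))
        fun k t => fourierCoeff (fun x => (ω t x : ℂ)) k := by
  rw [IsDuhamelSol, wienerNorm_ne_top_iff]
  refine and_congr_right fun hint => and_congr_right fun ⟨α, hα⟩ => ?_
  refine forall_congr' fun t => forall_congr' fun ht => forall_congr' fun k => ?_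
  have hs : ∀ τ, 0 ≤ τ → Summable fun k => ‖fourierCoeff (fun x => (ω τ x : ℂ)) k‖ :=
    fun τ hτ => hα.1.of_nonneg_of_le (fun _ => norm_nonneg _) fun k =>
      le_trans (le_mul_of_one_le_left (norm_nonneg _)
        (Real.one_le_exp (by positivity))) (hα.2 k τ hτ)
  rw [intervalIntegral.integral_congr (g := fun τ => heatMul σ ωav (t - τ) k *
    nlMode a (fun j => fourierCoeff (fun x => (ω τ x : ℂ)) j) k) fun τ hτ => ?_]
  rw [Set.uIcc_of_le ht] at hτ
  simp only
  rw [nonlinearity_eq_nlMode a (hint τ hτ.1) (hs τ hτ.1) k]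

/-- Global existence and uniqueness of small solutions in the Wiener-algebra based space
`B_ϖ^0` (Theorem `thm_ambrose`): for `a, ω_av ∈ ℝ`, `σ ≥ 1`, and zero-mean data
`ω₀ ∈ B₀` with `‖ω₀‖_{B₀} < 1/(4(|1+a|+|a|))` and `‖ω₀‖_{B₀} < (1−ϖ)/(4(|1+a|+|a|))`
for some `ϖ ∈ (0,1)`, the Duhamel fixed-point equation for the dissipative gCLM equation
has a solution in `B_ϖ^0` with data `ω₀`, unique up to a.e. equality at each time. -/
theorem stmt10 (a ωav σ ϖ : ℝ) (hσ : 1 ≤ σ) (hϖ0 : 0 < ϖ) (hϖ1 : ϖ < 1)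
    (ω₀ : AddCircle (2 * Real.pi) → ℝ)
    (hint : Integrable (fun x => (ω₀ x : ℂ)) volume)
    (hsum : Summable fun k : ℤ => ‖fourierCoeff (fun x => (ω₀ x : ℂ)) k‖)
    (hmean : fourierCoeff (fun x => (ω₀ x : ℂ)) 0 = 0)
    (hsmall : (∑' k : ℤ, ‖fourierCoeff (fun x => (ω₀ x : ℂ)) k‖) <
      1 / (4 * (|1 + a| + |a|)))
    (hsmall' : (∑' k : ℤ, ‖fourierCoeff (fun x => (ω₀ x : ℂ)) k‖) <
      (1 - ϖ) / (4 * (|1 + a| + |a|))) :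
    ∃ ω : ℝ → AddCircle (2 * Real.pi) → ℝ,
      IsDuhamelSol a ωav σ ϖ ω₀ ω ∧
      ∀ ω' : ℝ → AddCircle (2 * Real.pi) → ℝ,
        IsDuhamelSol a ωav σ ϖ ω₀ ω' →
        ∀ t : ℝ, 0 ≤ t → ω' t =ᵐ[volume] ω t := by
  set c : ℤ → ℂ := fourierCoeff fun x => (ω₀ x : ℂ)
  have hpos : 0 < |1 + a| + |a| := by
    have := abs_sub (1 + a) a
    rw [add_sub_cancel_right, abs_one] at this
    linarith
  obtain ⟨f, α, hf, hα⟩ := exists_isModeSol ωav hσ hϖ0.le hϖ1 hsum hpos hsmall'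
  have hreal : ∀ t, 0 ≤ t → ∀ k, starRingEnd ℂ (f (-k) t) = f k t := fun t ht k =>
    (hf.conj_neg (fourierCoeff_ofReal_neg ω₀)).unique hσ hϖ0.le hϖ1 hα.conj_neg hf hα hsum hpos
      hsmall' ht k
  have hs : ∀ t, 0 ≤ t → Summable fun k => ‖f k t‖ := fun t ht =>
    hα.1.of_nonneg_of_le (fun _ => norm_nonneg _) fun k =>
      le_trans (le_mul_of_one_le_left (norm_nonneg _)
        (Real.one_le_exp (by positivity))) (hα.2 k t ht)
  set ω : ℝ → AddCircle (2 * Real.pi) → ℝ := fun t x => (∑' k, f k t * fourier k x).re with hω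
  have hωt : ∀ t, 0 ≤ t → (fun x => (ω t x : ℂ)) = fun x => ∑' k, f k t * fourier k x := by
    intro t ht
    ext x
    refine Complex.conj_eq_iff_re.1 ?_
    rw [Complex.conj_tsum, ← (Equiv.neg ℤ).tsum_eq]
    refine tsum_congr fun k => ?_
    rw [Equiv.neg_apply, map_mul, hreal t ht, fourier_neg, Complex.conj_conj]
  have hcoeff : ∀ t, 0 ≤ t → ∀ k, fourierCoeff (fun x => (ω t x : ℂ)) k = f k t :=
    fun t ht k => by rw [hωt t ht, fourierCoeff_tsum (hs t ht)]
  have hsol : IsDuhamelSol a ωav σ ϖ ω₀ ω := by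
    refine (isDuhamelSol_iff hϖ0.le).2 ⟨fun t ht => ?_, ⟨α, hα.1, fun k t ht => ?_⟩,
      fun t ht k => ?_⟩
    · rw [hωt t ht, ← integrable_haarAddCircle_iff]
      exact (continuous_tsum_fourier (hs t ht)).integrable_of_hasCompactSupport
        (HasCompactSupport.of_compactSpace _)
    · simp only [hcoeff t ht]
      exact hα.2 k t ht
    · beta_reduce
      rw [hcoeff t ht, hf t ht k]
      congr 1
      refine intervalIntegral.integral_congr fun τ hτ => ?_
      rw [Set.uIcc_of_le ht] at hτ
      simp only [hcoeff τ hτ.1]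
  refine ⟨ω, hsol, fun ω' hsol' t ht => ?_⟩
  obtain ⟨hint', ⟨β, hβ⟩, hg⟩ := (isDuhamelSol_iff hϖ0.le).1 hsol'
  refine ae_eq_of_fourierCoeff_ofReal_eq (hint' t ht) (hsol.1 t ht) fun k => ?_
  rw [hcoeff t ht]
  exact hg.unique hσ hϖ0.le hϖ1 hβ hf hα hsum hpos hsmall' ht k

end
end

section
/- Consider the planar ODE system dΩ/dt = (Ω/v_c)(Ω/2 − 1), dv_c/dt = 1 − Ω/4, with initial data Ω(0) > 0 and v_c(0) > 0. Then: (1) if Ω(0) > 2, the maximal forward solution exists only on a finite interval [0, t_c) with t_c < ∞, and v_c(t) → 0 as t → t_c⁻ while Ω(t) → ∞; (2) if 0 < Ω(0) ≤ 2, the solution exists for all t ≥ 0, v_c(t) is strictly increasing in t, and v_c(t) > 0 for all t ≥ 0. -/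
open Set Filter

/-- An increasing homeomorphism of the line has an increasing inverse, differentiable wherever
the derivative of the original map does not vanish. -/
theorem exists_inverse_hasDerivAt {T T' : ℝ → ℝ} (hmono : StrictMono T)
    (hsurj : Function.Surjective T) (hT : ∀ x, HasDerivAt T (T' x) x) :
    ∃ θ : ℝ → ℝ, StrictMono θ ∧ Continuous θ ∧ (∀ x, θ (T x) = x) ∧
      ∀ t, T' (θ t) ≠ 0 → HasDerivAt θ (T' (θ t))⁻¹ t := by
  let e := hmono.orderIsoOfSurjective T hsurj
  have hT_symm : ∀ t, T (e.symm t) = t := e.apply_symm_apply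
  exact ⟨e.symm, e.symm.strictMono, e.symm.continuous, e.symm_apply_apply, fun t ht =>
    (hT _).of_local_left_inverse e.symm.continuous.continuousAt ht (Eventually.of_forall hT_symm)⟩

theorem strictMono_add_sin_mul_cos : StrictMono fun x : ℝ => x + Real.sin x * Real.cos x := by
  intro x y hxy
  have hsin : |Real.sin (y - x)| < y - x := by
    simpa [abs_of_pos (sub_pos.2 hxy)] using Real.abs_sin_lt_abs (sub_pos.2 hxy).ne'
  have hprod : |Real.sin (y - x) * Real.cos (y + x)| ≤ |Real.sin (y - x)| := by
    rw [abs_mul]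
    exact mul_le_of_le_one_right (abs_nonneg _) (Real.abs_cos_le_one _)
  have hid : Real.sin (y - x) * Real.cos (y + x)
      = Real.sin y * Real.cos y - Real.sin x * Real.cos x := by
    rw [Real.sin_sub, Real.cos_add]
    linear_combination (Real.sin y * Real.cos y) * Real.sin_sq_add_cos_sq x
      - (Real.sin x * Real.cos x) * Real.sin_sq_add_cos_sq y
  have := neg_abs_le (Real.sin (y - x) * Real.cos (y + x))
  show x + Real.sin x * Real.cos x < y + Real.sin y * Real.cos y
  linarith

theorem surjective_add_sin_mul_cos :
    Function.Surjective fun x : ℝ => x + Real.sin x * Real.cos x := by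
  have hbound : ∀ x : ℝ, |Real.sin x * Real.cos x| ≤ 1 := fun x => by
    rw [abs_mul]
    exact mul_le_one₀ (Real.abs_sin_le_one x) (abs_nonneg _) (Real.abs_cos_le_one x)
  refine Continuous.surjective (by fun_prop) ?_ ?_
  · exact tendsto_atTop_mono (fun x => by simp only [id]; linarith [neg_le_of_abs_le (hbound x)])
      (tendsto_atTop_add_const_right _ (-1) tendsto_id)
  · exact tendsto_atBot_mono (fun x => by simp only [id]; linarith [le_of_abs_le (hbound x)])
      (tendsto_atBot_add_const_right _ 1 tendsto_id)

theorem strictMono_sinh_mul_cosh : StrictMono fun x : ℝ => Real.sinh x * Real.cosh x := by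
  intro x y hxy
  have := Real.sinh_strictMono (show 2 * x < 2 * y by linarith)
  rw [Real.sinh_two_mul, Real.sinh_two_mul] at this
  show Real.sinh x * Real.cosh x < Real.sinh y * Real.cosh y
  linarith

theorem surjective_add_sinh_mul_cosh :
    Function.Surjective fun x : ℝ => x + Real.sinh x * Real.cosh x := by
  refine Continuous.surjective (by fun_prop) ?_ ?_
  · refine tendsto_atTop_mono' _ ?_ tendsto_id
    filter_upwards [eventually_ge_atTop 0] with x hx
    simpa using mul_nonneg (Real.sinh_nonneg_iff.2 hx) (Real.cosh_pos x).le
  · refine tendsto_atBot_mono' _ ?_ tendsto_id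
    filter_upwards [eventually_le_atBot 0] with x hx
    simpa using mul_nonpos_of_nonpos_of_nonneg (Real.sinh_nonpos_iff.2 hx) (Real.cosh_pos x).le

theorem StrictMono.mul_sub_const {g : ℝ → ℝ} (hg : StrictMono g) {K : ℝ} (hK : 0 < K) (c : ℝ) :
    StrictMono fun x => K * g x - c := fun _ _ h =>
  sub_lt_sub_right (mul_lt_mul_of_pos_left (hg h) hK) c

theorem Function.Surjective.mul_sub_const {g : ℝ → ℝ} (hg : Function.Surjective g) {K : ℝ}
    (hK : 0 < K) (c : ℝ) : Function.Surjective fun x => K * g x - c := fun y => by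
  obtain ⟨x, hx⟩ := hg ((y + c) / K)
  exact ⟨x, by simp only [hx]; field_simp; ring⟩

theorem le_initial_of_hasDerivWithinAt_nonpos {f f' : ℝ → ℝ}
    (hf : ∀ t ∈ Ici (0 : ℝ), HasDerivWithinAt f (f' t) (Ici 0) t)
    (hf' : ∀ t ∈ Ici (0 : ℝ), f' t ≤ 0) {t : ℝ} (ht : 0 ≤ t) : f t ≤ f 0 := by
  have hanti : AntitoneOn f (Ici 0) := by
    refine antitoneOn_of_hasDerivWithinAt_nonpos (f' := f') (convex_Ici 0)
      (fun t ht => (hf t ht).continuousWithinAt)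
      (fun t ht => (hf t (interior_subset ht)).mono interior_subset)
      (fun t ht => hf' t (interior_subset ht))
  exact hanti self_mem_Ici ht ht

/-- The solution blowing up in finite time: `Ω = 2 / cos² θ`, `v = K sin θ cos θ`, where
`θ' = 1 / (2 K cos² θ)`. -/
theorem exists_collapsing_solution {Ω₀ v₀ : ℝ} (hΩ₀ : 2 < Ω₀) (hv₀ : 0 < v₀) :
    ∃ tc : ℝ, 0 < tc ∧ ∃ Om vc : ℝ → ℝ,
      Om 0 = Ω₀ ∧ vc 0 = v₀ ∧
      (∀ t ∈ Ico (0 : ℝ) tc, 0 < vc t) ∧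
      (∀ t ∈ Ico (0 : ℝ) tc,
        HasDerivWithinAt Om (Om t / vc t * (Om t / 2 - 1)) (Ico (0 : ℝ) tc) t) ∧
      (∀ t ∈ Ico (0 : ℝ) tc,
        HasDerivWithinAt vc (1 - Om t / 4) (Ico (0 : ℝ) tc) t) ∧
      Tendsto vc (nhdsWithin tc (Iio tc)) (nhds 0) ∧
      Tendsto Om (nhdsWithin tc (Iio tc)) atTop := by
  have hΩpos : 0 < Ω₀ := by linarith
  obtain ⟨θ₀, hθ₀, hθ₀', hcos₀⟩ : ∃ θ₀ : ℝ, 0 < θ₀ ∧ θ₀ < Real.pi / 2 ∧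
      Real.cos θ₀ ^ 2 = 2 / Ω₀ := by
    have hpos : 0 < √(2 / Ω₀) := Real.sqrt_pos.2 (by positivity)
    have hlt : √(2 / Ω₀) < 1 := by
      rw [Real.sqrt_lt' one_pos, one_pow, div_lt_one hΩpos]; exact hΩ₀
    refine ⟨Real.arccos √(2 / Ω₀), Real.arccos_pos.2 hlt, Real.arccos_lt_pi_div_two.2 hpos, ?_⟩
    rw [Real.cos_arccos (by linarith) hlt.le, Real.sq_sqrt (by positivity)]
  have hsin_pos : ∀ x, θ₀ ≤ x → x < Real.pi / 2 → 0 < Real.sin x := fun x h₁ h₂ =>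
    Real.sin_pos_of_pos_of_lt_pi (by linarith) (by linarith [Real.pi_pos])
  have hcos_pos : ∀ x, θ₀ ≤ x → x < Real.pi / 2 → 0 < Real.cos x := fun x h₁ h₂ =>
    Real.cos_pos_of_mem_Ioo ⟨by linarith [Real.pi_pos], h₂⟩
  have hs₀ := hsin_pos θ₀ le_rfl hθ₀'
  have hc₀ := hcos_pos θ₀ le_rfl hθ₀'
  obtain ⟨K, hK, hKv⟩ : ∃ K : ℝ, 0 < K ∧ K * (Real.sin θ₀ * Real.cos θ₀) = v₀ :=
    ⟨v₀ / (Real.sin θ₀ * Real.cos θ₀), by positivity, by field_simp⟩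
  set c : ℝ := K * (θ₀ + Real.sin θ₀ * Real.cos θ₀)
  set T : ℝ → ℝ := fun x => K * (x + Real.sin x * Real.cos x) - c
  have hTmono : StrictMono T := strictMono_add_sin_mul_cos.mul_sub_const hK c
  have hT : ∀ x, HasDerivAt T (2 * K * Real.cos x ^ 2) x := fun x => by
    refine ((((hasDerivAt_id x).add ((Real.hasDerivAt_sin x).mul
      (Real.hasDerivAt_cos x))).const_mul K).sub_const c).congr_deriv ?_
    linear_combination (-K) * Real.sin_sq_add_cos_sq x
  obtain ⟨θ, hθmono, hθcont, hθT, hθderiv⟩ := exists_inverse_hasDerivAt hTmono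
    (surjective_add_sin_mul_cos.mul_sub_const hK c) hT
  have hT₀ : T θ₀ = 0 := sub_self _
  have hθ_zero : θ 0 = θ₀ := by rw [← hT₀, hθT]
  have hθ_tc : θ (T (Real.pi / 2)) = Real.pi / 2 := hθT _
  have hθ_mem : ∀ t ∈ Ico 0 (T (Real.pi / 2)), θ₀ ≤ θ t ∧ θ t < Real.pi / 2 := fun t ht =>
    ⟨hθ_zero ▸ hθmono.monotone ht.1, hθ_tc ▸ hθmono ht.2⟩
  have htc : 0 < T (Real.pi / 2) := hT₀ ▸ hTmono hθ₀'
  refine ⟨T (Real.pi / 2), htc, fun t => 2 / Real.cos (θ t) ^ 2,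
    fun t => K * (Real.sin (θ t) * Real.cos (θ t)), ?_, ?_, ?_, ?_, ?_, ?_, ?_⟩
  · simp only [hθ_zero, hcos₀]
    field_simp
  · simpa only [hθ_zero] using hKv
  · intro t ht
    obtain ⟨h₁, h₂⟩ := hθ_mem t ht
    have := hsin_pos _ h₁ h₂
    have := hcos_pos _ h₁ h₂
    positivity
  · intro t ht
    obtain ⟨h₁, h₂⟩ := hθ_mem t ht
    have hs := hsin_pos _ h₁ h₂
    have hco := hcos_pos _ h₁ h₂
    have hd := hθderiv t (by positivity)
    refine (((hasDerivAt_const t (2 : ℝ)).fun_div (hd.cos.fun_pow 2)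
      (by positivity)).congr_deriv ?_).hasDerivWithinAt
    have hid : 2 / Real.cos (θ t) ^ 2 / 2 - 1 = Real.sin (θ t) ^ 2 / Real.cos (θ t) ^ 2 := by
      rw [Real.sin_sq]; field_simp
    rw [hid]
    field_simp
    norm_num [mul_comm]
  · intro t ht
    obtain ⟨h₁, h₂⟩ := hθ_mem t ht
    have hco := hcos_pos _ h₁ h₂
    have hd := hθderiv t (by positivity)
    refine (((hd.sin.fun_mul hd.cos).const_mul K).congr_deriv ?_).hasDerivWithinAt
    field_simp
    linear_combination (-4) * Real.sin_sq_add_cos_sq (θ t)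
  · have hcont : Continuous fun t => K * (Real.sin (θ t) * Real.cos (θ t)) := by fun_prop
    have hlim := hcont.tendsto (T (Real.pi / 2))
    simp only [hθ_tc, Real.cos_pi_div_two, mul_zero] at hlim
    exact hlim.mono_left nhdsWithin_le_nhds
  · have hcont : Continuous fun t => Real.cos (θ t) ^ 2 := by fun_prop
    have hlim := hcont.tendsto (T (Real.pi / 2))
    simp only [hθ_tc, Real.cos_pi_div_two, ne_eq, OfNat.ofNat_ne_zero, not_false_eq_true,
      zero_pow] at hlim
    have hpos : ∀ᶠ t in nhdsWithin (T (Real.pi / 2)) (Iio (T (Real.pi / 2))),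
        Real.cos (θ t) ^ 2 ∈ Ioi (0 : ℝ) := by
      filter_upwards [Ico_mem_nhdsLT htc] with t ht
      obtain ⟨h₁, h₂⟩ := hθ_mem t ht
      exact pow_pos (hcos_pos _ h₁ h₂) 2
    have hinv := (tendsto_nhdsWithin_iff.2
      ⟨hlim.mono_left nhdsWithin_le_nhds, hpos⟩).inv_tendsto_nhdsGT_zero
    exact hinv.const_mul_atTop two_pos

/-- The quantity `(Ω - 2) / (v Ω)²` is conserved, which forces `1 / (v Ω)` to decrease at least
linearly. -/
theorem not_exists_global_solution {Ω₀ v₀ : ℝ} (hΩ₀ : 2 < Ω₀) (hv₀ : 0 < v₀) :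
    ¬ (∃ Om vc : ℝ → ℝ,
      Om 0 = Ω₀ ∧ vc 0 = v₀ ∧
      (∀ t ∈ Ici (0 : ℝ), 0 < vc t) ∧
      (∀ t ∈ Ici (0 : ℝ),
        HasDerivWithinAt Om (Om t / vc t * (Om t / 2 - 1)) (Ici (0 : ℝ)) t) ∧
      (∀ t ∈ Ici (0 : ℝ),
        HasDerivWithinAt vc (1 - Om t / 4) (Ici (0 : ℝ)) t)) := by
  rintro ⟨Om, vc, hOm0, hvc0, hpos, hOm, hvc⟩
  have hω : ∀ t ∈ Ici (0 : ℝ),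
      HasDerivWithinAt (fun t => vc t * Om t) (Om t ^ 2 / 4) (Ici 0) t := fun t ht => by
    have hv := hpos t ht
    refine ((hvc t ht).fun_mul (hOm t ht)).congr_deriv ?_
    field_simp
    ring
  have hω_pos : ∀ t ∈ Ici (0 : ℝ), 0 < vc t * Om t := fun t ht => by
    have h := le_initial_of_hasDerivWithinAt_nonpos (fun t ht => (hω t ht).fun_neg)
      (fun t _ => by nlinarith [sq_nonneg (Om t)]) ht
    simp only [hOm0, hvc0] at h
    have : 0 < v₀ * Ω₀ := by nlinarith
    linarith
  have hOm_pos : ∀ t ∈ Ici (0 : ℝ), 0 < Om t := fun t ht =>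
    (pos_iff_pos_of_mul_pos (hω_pos t ht)).1 (hpos t ht)
  have hconserved : ∀ t ∈ Ici (0 : ℝ),
      HasDerivWithinAt (fun t => -((Om t - 2) / (vc t * Om t) ^ 2)) 0 (Ici 0) t := fun t ht => by
    have hv := hpos t ht
    have ho := hOm_pos t ht
    refine ((((hOm t ht).sub_const 2).fun_div ((hω t ht).fun_pow 2)
      (by positivity)).fun_neg).congr_deriv ?_
    field_simp
    ring
  obtain ⟨c, hc⟩ : ∃ c : ℝ, c = (Ω₀ - 2) / (v₀ * Ω₀) ^ 2 := ⟨_, rfl⟩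
  have hc_pos : 0 < c := by
    rw [hc]
    exact div_pos (by linarith) (pow_pos (mul_pos hv₀ (by linarith)) 2)
  have hlower : ∀ t ∈ Ici (0 : ℝ), c * (vc t * Om t) ^ 2 ≤ Om t - 2 := fun t ht => by
    have h := le_initial_of_hasDerivWithinAt_nonpos hconserved (fun _ _ => le_rfl) ht
    simp only [hOm0, hvc0, ← hc, neg_le_neg_iff] at h
    exact (le_div_iff₀ (pow_pos (hω_pos t ht) 2)).1 h
  have hinv : ∀ t ∈ Ici (0 : ℝ),
      HasDerivWithinAt (fun t => (vc t * Om t)⁻¹ + 2 * c * t)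
        (-(Om t ^ 2 / 4) / (vc t * Om t) ^ 2 + 2 * c * 1) (Ici 0) t := fun t ht =>
    ((hω t ht).fun_inv (hω_pos t ht).ne').fun_add ((hasDerivWithinAt_id t _).const_mul (2 * c))
  have hdecay : ∀ t ∈ Ici (0 : ℝ),
      -(Om t ^ 2 / 4) / (vc t * Om t) ^ 2 + 2 * c * 1 ≤ 0 := fun t ht => by
    have hw := pow_pos (hω_pos t ht) 2
    have h : 2 * c ≤ (Om t ^ 2 / 4) / (vc t * Om t) ^ 2 := by
      rw [le_div_iff₀ hw]
      nlinarith [hlower t ht, sq_nonneg (Om t - 4)]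
    rw [neg_div]
    linarith
  have ht₁ : (0 : ℝ) ≤ (v₀ * Ω₀)⁻¹ / (2 * c) := by
    have : 0 < Ω₀ := by linarith
    positivity
  have h := le_initial_of_hasDerivWithinAt_nonpos hinv hdecay ht₁
  simp only [hOm0, hvc0, mul_zero, add_zero] at h
  rw [mul_div_cancel₀ _ (by positivity : 2 * c ≠ 0)] at h
  linarith [inv_pos.2 (hω_pos _ ht₁)]

/-- The global solution: `Ω = 2 / cosh² u`, `v = K sinh u cosh u`, where
`u' = 1 / (2 K cosh² u)`. -/
theorem exists_global_solution_of_lt_two {Ω₀ v₀ : ℝ} (hΩ₀ : 0 < Ω₀) (hlt : Ω₀ < 2)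
    (hv₀ : 0 < v₀) :
    ∃ Om vc : ℝ → ℝ,
      Om 0 = Ω₀ ∧ vc 0 = v₀ ∧
      (∀ t ∈ Ici (0 : ℝ), 0 < vc t) ∧
      (∀ t ∈ Ici (0 : ℝ),
        HasDerivWithinAt Om (Om t / vc t * (Om t / 2 - 1)) (Ici (0 : ℝ)) t) ∧
      (∀ t ∈ Ici (0 : ℝ),
        HasDerivWithinAt vc (1 - Om t / 4) (Ici (0 : ℝ)) t) ∧
      StrictMonoOn vc (Ici (0 : ℝ)) := by
  obtain ⟨u₀, hu₀, hcosh₀⟩ : ∃ u₀ : ℝ, 0 < u₀ ∧ Real.cosh u₀ ^ 2 = 2 / Ω₀ := by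
    have hpos : 0 < 2 / Ω₀ - 1 := by rw [sub_pos, one_lt_div hΩ₀]; exact hlt
    refine ⟨Real.arsinh √(2 / Ω₀ - 1), Real.arsinh_pos_iff.2 (Real.sqrt_pos.2 hpos), ?_⟩
    rw [Real.cosh_sq, Real.sinh_arsinh, Real.sq_sqrt hpos.le]
    ring
  have hs₀ := Real.sinh_pos_iff.2 hu₀
  have hc₀ := Real.cosh_pos u₀
  obtain ⟨K, hK, hKv⟩ : ∃ K : ℝ, 0 < K ∧ K * (Real.sinh u₀ * Real.cosh u₀) = v₀ :=
    ⟨v₀ / (Real.sinh u₀ * Real.cosh u₀), by positivity, by field_simp⟩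
  set c : ℝ := K * (u₀ + Real.sinh u₀ * Real.cosh u₀)
  set T : ℝ → ℝ := fun x => K * (x + Real.sinh x * Real.cosh x) - c
  have hTmono : StrictMono T := (strictMono_id.add strictMono_sinh_mul_cosh).mul_sub_const hK c
  have hT : ∀ x, HasDerivAt T (2 * K * Real.cosh x ^ 2) x := fun x => by
    refine ((((hasDerivAt_id x).add ((Real.hasDerivAt_sinh x).mul
      (Real.hasDerivAt_cosh x))).const_mul K).sub_const c).congr_deriv ?_
    linear_combination (-K) * Real.cosh_sq x
  obtain ⟨u, humono, -, huT, huderiv⟩ := exists_inverse_hasDerivAt hTmono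
    (surjective_add_sinh_mul_cosh.mul_sub_const hK c) hT
  have hu_zero : u 0 = u₀ := by rw [← sub_self c, ← huT u₀]
  have hu_pos : ∀ t ∈ Ici (0 : ℝ), 0 < u t := fun t ht =>
    (hu_zero ▸ hu₀).trans_le (humono.monotone ht)
  have hd : ∀ t, HasDerivAt u (2 * K * Real.cosh (u t) ^ 2)⁻¹ t := fun t =>
    huderiv t (mul_pos (by positivity) (pow_pos (Real.cosh_pos _) 2)).ne'
  refine ⟨fun t => 2 / Real.cosh (u t) ^ 2,
    fun t => K * (Real.sinh (u t) * Real.cosh (u t)), ?_, ?_, ?_, ?_, ?_, ?_⟩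
  · simp only [hu_zero, hcosh₀]
    field_simp
  · simpa only [hu_zero] using hKv
  · intro t ht
    have := Real.sinh_pos_iff.2 (hu_pos t ht)
    have := Real.cosh_pos (u t)
    positivity
  · intro t ht
    have hs := Real.sinh_pos_iff.2 (hu_pos t ht)
    have hco := Real.cosh_pos (u t)
    refine (((hasDerivAt_const t (2 : ℝ)).fun_div ((hd t).cosh.fun_pow 2)
      (by positivity)).congr_deriv ?_).hasDerivWithinAt
    have hid : 2 / Real.cosh (u t) ^ 2 / 2 - 1
        = -(Real.sinh (u t) ^ 2 / Real.cosh (u t) ^ 2) := by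
      rw [Real.sinh_sq]; field_simp; ring
    rw [hid]
    field_simp
    norm_num [mul_comm]
  · intro t ht
    have hco := Real.cosh_pos (u t)
    refine ((((hd t).sinh.fun_mul (hd t).cosh).const_mul K).congr_deriv ?_).hasDerivWithinAt
    field_simp
    linear_combination (-4) * Real.cosh_sq (u t)
  · exact fun s _ t _ hst =>
      mul_lt_mul_of_pos_left (strictMono_sinh_mul_cosh (humono hst)) hK

/-- Behavior of the planar system `dΩ/dt = (Ω/v)(Ω/2 − 1)`, `dv/dt = 1 − Ω/4` with
`Ω(0) = Ω₀ > 0`, `v(0) = v₀ > 0` (the pole-dynamics system for `a = 1/2`, `σ = 1`, `ν = 1`):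
(1) if `Ω₀ > 2`, there is a finite `t_c > 0` and a solution on `[0, t_c)` (with `v > 0`)
along which `v → 0` and `Ω → ∞` as `t → t_c⁻`, and there is no global solution on `[0, ∞)`
with `v > 0`; (2) if `Ω₀ ≤ 2`, there is a global solution on `[0, ∞)` with `v > 0`
everywhere and `v` strictly increasing. -/
theorem stmt14 (Ω₀ v₀ : ℝ) (hΩ₀ : 0 < Ω₀) (hv₀ : 0 < v₀) :
    (2 < Ω₀ →
      (∃ tc : ℝ, 0 < tc ∧ ∃ Om vc : ℝ → ℝ,
        Om 0 = Ω₀ ∧ vc 0 = v₀ ∧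
        (∀ t ∈ Ico (0 : ℝ) tc, 0 < vc t) ∧
        (∀ t ∈ Ico (0 : ℝ) tc,
          HasDerivWithinAt Om (Om t / vc t * (Om t / 2 - 1)) (Ico (0 : ℝ) tc) t) ∧
        (∀ t ∈ Ico (0 : ℝ) tc,
          HasDerivWithinAt vc (1 - Om t / 4) (Ico (0 : ℝ) tc) t) ∧
        Tendsto vc (nhdsWithin tc (Iio tc)) (nhds 0) ∧
        Tendsto Om (nhdsWithin tc (Iio tc)) atTop) ∧
      ¬ (∃ Om vc : ℝ → ℝ,
        Om 0 = Ω₀ ∧ vc 0 = v₀ ∧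
        (∀ t ∈ Ici (0 : ℝ), 0 < vc t) ∧
        (∀ t ∈ Ici (0 : ℝ),
          HasDerivWithinAt Om (Om t / vc t * (Om t / 2 - 1)) (Ici (0 : ℝ)) t) ∧
        (∀ t ∈ Ici (0 : ℝ),
          HasDerivWithinAt vc (1 - Om t / 4) (Ici (0 : ℝ)) t))) ∧
    (Ω₀ ≤ 2 →
      ∃ Om vc : ℝ → ℝ,
        Om 0 = Ω₀ ∧ vc 0 = v₀ ∧
        (∀ t ∈ Ici (0 : ℝ), 0 < vc t) ∧
        (∀ t ∈ Ici (0 : ℝ),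
          HasDerivWithinAt Om (Om t / vc t * (Om t / 2 - 1)) (Ici (0 : ℝ)) t) ∧
        (∀ t ∈ Ici (0 : ℝ),
          HasDerivWithinAt vc (1 - Om t / 4) (Ici (0 : ℝ)) t) ∧
        StrictMonoOn vc (Ici (0 : ℝ))) := by
  refine ⟨fun h => ⟨exists_collapsing_solution h hv₀, not_exists_global_solution h hv₀⟩,
    fun h => ?_⟩
  rcases h.lt_or_eq with h | rfl
  · exact exists_global_solution_of_lt_two hΩ₀ h hv₀
  · refine ⟨fun _ => 2, fun t => v₀ + 1 / 2 * t, rfl, by simp, ?_, ?_, ?_, ?_⟩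
    · intro t (ht : 0 ≤ t)
      positivity
    · intro t _
      simpa using hasDerivWithinAt_const t (Ici (0 : ℝ)) (2 : ℝ)
    · intro t _
      exact (((hasDerivWithinAt_id t _).const_mul (1 / 2)).const_add v₀).congr_deriv (by norm_num)
    · intro s _ t _ hst
      show v₀ + 1 / 2 * s < v₀ + 1 / 2 * t
      linarith
end
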